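/- Let N ≥ 2, let H be a Finsler norm on ℝ^N, and let B satisfy assumption (h_B) with p ≥ 2, κ = 0, and parameters γ > 0, Γ > 0. Let u be a weak solution of −div(B'(H(∇u))∇H(∇u)) = |u|^{q−1}u in ℝ^N which is stable outside a compact set K ⊂ ℝ^N, and assume either Γγ^{−1}(p−1) < q < ∞ and N ≤ pγΓ^{−1}, or Γγ^{−1}(p−1) < q < [N(p − Γ/γ) + p] / [N(Γ/γ) − p] and N > pγΓ^{−1}. Then B(H(∇u)) ∈ L¹(ℝ^N) and u ∈ L^{q+1}(ℝ^N). -/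

import Mathlib

open MeasureTheory Real Set
open scoped RealInnerProductSpace

noncomputable section

/-- A Finsler norm on `ℝ^N`: a norm of class `C²` away from the origin whose
open unit ball is uniformly convex. -/
def IsFinslerNorm {N : ℕ} (H : EuclideanSpace ℝ (Fin N) → ℝ) : Prop :=
  (∀ x, H x = 0 ↔ x = 0) ∧
  (∀ (c : ℝ) (x : EuclideanSpace ℝ (Fin N)), H (c • x) = |c| * H x) ∧
  (∀ x y, H (x + y) ≤ H x + H y) ∧
  ContDiffOn ℝ 2 H {(0 : EuclideanSpace ℝ (Fin N))}ᶜ ∧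
  ∃ Λ : ℝ, 0 < Λ ∧ ∀ ξ : EuclideanSpace ℝ (Fin N), H ξ = 1 →
    ∀ v : EuclideanSpace ℝ (Fin N), ⟪gradient H ξ, v⟫ = 0 →
      Λ * ‖v‖ ^ 2 ≤ ⟪fderiv ℝ (gradient H) ξ v, v⟫

/-- Assumption `(h_B)` with parameters `p, κ, γ, Γ`. -/
def SatisfiesHB (B : ℝ → ℝ) (p κ γ Γ : ℝ) : Prop :=
  ContDiffOn ℝ 2 B (Set.Ioi 0) ∧ B 0 = 0 ∧ deriv B 0 = 0 ∧
  (∀ t : ℝ, 0 < t → 0 < B t ∧ 0 < deriv B t ∧ 0 < deriv (deriv B) t) ∧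
  1 < p ∧ 0 ≤ κ ∧ κ ≤ 1 ∧ 0 < γ ∧ 0 < Γ ∧
  (∀ t : ℝ, 0 < t →
    γ * (κ + t) ^ (p - 2) * t ≤ deriv B t ∧ deriv B t ≤ Γ * (κ + t) ^ (p - 2) * t) ∧
  (∀ t : ℝ, 0 < t →
    γ * (p - 1) * (κ + t) ^ (p - 2) ≤ deriv (deriv B) t ∧
      deriv (deriv B) t ≤ Γ * (p - 1) * (κ + t) ^ (p - 2))

/-- `u` is a weak solution of `-div(B'(H(∇u)) ∇H(∇u)) = |u|^{q-1} u` in `Ω`. -/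
def IsWeakSolutionOn {N : ℕ} (Ω : Set (EuclideanSpace ℝ (Fin N))) (B : ℝ → ℝ)
    (H : EuclideanSpace ℝ (Fin N) → ℝ) (u : EuclideanSpace ℝ (Fin N) → ℝ) (q : ℝ) : Prop :=
  ∀ φ : EuclideanSpace ℝ (Fin N) → ℝ, ContDiff ℝ 1 φ → HasCompactSupport φ → tsupport φ ⊆ Ω →
    ∫ x in Ω, deriv B (H (gradient u x)) * ⟪gradient H (gradient u x), gradient φ x⟫
      = ∫ x in Ω, |u x| ^ (q - 1) * u x * φ x

/-- Stability of the linearized operator of `u`, tested against `C¹` functions compactly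
supported in `S ⊆ Ω` (take `S = Ω` for stability, `S = Ω \ K` for stability outside a
compact set `K`). -/
def IsStableOn {N : ℕ} (Ω S : Set (EuclideanSpace ℝ (Fin N))) (B : ℝ → ℝ)
    (H : EuclideanSpace ℝ (Fin N) → ℝ) (u : EuclideanSpace ℝ (Fin N) → ℝ) (q : ℝ) : Prop :=
  ∀ φ : EuclideanSpace ℝ (Fin N) → ℝ, ContDiff ℝ 1 φ → HasCompactSupport φ → tsupport φ ⊆ S →
    0 ≤ (∫ x in Ω, deriv (deriv B) (H (gradient u x)) *
            ⟪gradient H (gradient u x), gradient φ x⟫ ^ 2)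
        + (∫ x in Ω, deriv B (H (gradient u x)) *
            ⟪fderiv ℝ (gradient H) (gradient u x) (gradient φ x), gradient φ x⟫)
        - ∫ x in Ω, q * |u x| ^ (q - 1) * φ x ^ 2


section Finsler

variable {N : ℕ} {H : EuclideanSpace ℝ (Fin N) → ℝ}

namespace IsFinslerNorm

lemma zero (hH : IsFinslerNorm H) : H 0 = 0 := (hH.1 0).2 rfl

lemma neg (hH : IsFinslerNorm H) (x : EuclideanSpace ℝ (Fin N)) : H (-x) = H x := by
  simpa using hH.2.1 (-1) x

lemma nonneg (hH : IsFinslerNorm H) (x : EuclideanSpace ℝ (Fin N)) : 0 ≤ H x := by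
  have h := hH.2.2.1 x (-x)
  rw [add_neg_cancel, hH.zero, hH.neg] at h
  linarith

lemma pos (hH : IsFinslerNorm H) {x : EuclideanSpace ℝ (Fin N)} (hx : x ≠ 0) : 0 < H x :=
  (hH.nonneg x).lt_of_ne fun h => hx ((hH.1 x).1 h.symm)

lemma le_mul_norm (hH : IsFinslerNorm H) : ∃ C : ℝ, 0 < C ∧ ∀ x, H x ≤ C * ‖x‖ := by
  refine ⟨(∑ i, H (EuclideanSpace.single i 1)) + 1, ?_, fun x => ?_⟩
  · have := Finset.sum_nonneg (s := Finset.univ) fun i _ =>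
      hH.nonneg (EuclideanSpace.single (i : Fin N) (1 : ℝ))
    linarith
  have hsum : ∀ s : Finset (Fin N), H (∑ i ∈ s, x i • EuclideanSpace.single i (1 : ℝ)) ≤
      ∑ i ∈ s, ‖x‖ * H (EuclideanSpace.single i 1) := by
    intro s
    induction s using Finset.induction_on with
    | empty => simp [hH.zero]
    | insert a s ha ih =>
      rw [Finset.sum_insert ha, Finset.sum_insert ha]
      refine (hH.2.2.1 _ _).trans (add_le_add ?_ ih)
      rw [hH.2.1]
      exact mul_le_mul_of_nonneg_right (PiLp.norm_apply_le x a) (hH.nonneg _)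
  have hx : x = ∑ i, x i • EuclideanSpace.single i (1 : ℝ) := by
    have := (EuclideanSpace.basisFun (Fin N) ℝ).sum_repr x
    simpa using this.symm
  calc H x = H (∑ i, x i • EuclideanSpace.single i (1 : ℝ)) := by rw [← hx]
    _ ≤ ∑ i, ‖x‖ * H (EuclideanSpace.single i 1) := hsum _
    _ ≤ _ := by rw [← Finset.mul_sum]; nlinarith [norm_nonneg x]

lemma continuous (hH : IsFinslerNorm H) : Continuous H := by
  obtain ⟨C, hC, h⟩ := hH.le_mul_norm
  refine (LipschitzWith.of_le_add_mul C.toNNReal fun x y => ?_).continuous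
  have h1 := hH.2.2.1 y (x - y)
  rw [add_sub_cancel] at h1
  rw [Real.coe_toNNReal _ hC.le, dist_eq_norm]
  linarith [h (x - y)]

lemma norm_le_mul (hH : IsFinslerNorm H) : ∃ C : ℝ, 0 < C ∧ ∀ x, ‖x‖ ≤ C * H x := by
  rcases (Metric.sphere (0 : EuclideanSpace ℝ (Fin N)) 1).eq_empty_or_nonempty with he | hne
  · refine ⟨1, one_pos, fun x => ?_⟩
    by_cases hx : x = 0
    · simp [hx, hH.zero]
    · have : (‖x‖⁻¹ • x) ∈ Metric.sphere (0 : EuclideanSpace ℝ (Fin N)) 1 := by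
        simp [norm_smul, hx]
      simp [he] at this
  obtain ⟨z, hz, hmin⟩ := (isCompact_sphere _ _).exists_isMinOn hne hH.continuous.continuousOn
  have hz0 : z ≠ 0 := by
    rintro rfl
    simp at hz
  refine ⟨(H z)⁻¹, inv_pos.2 (hH.pos hz0), fun x => ?_⟩
  by_cases hx : x = 0
  · simp [hx, hH.zero]
  have hmem : (‖x‖⁻¹ • x) ∈ Metric.sphere (0 : EuclideanSpace ℝ (Fin N)) 1 := by
    simp [norm_smul, hx]
  have h1 : H z ≤ H (‖x‖⁻¹ • x) := hmin hmem
  have hxn : 0 < ‖x‖ := norm_pos_iff.2 hx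
  rw [hH.2.1, abs_of_pos (inv_pos.2 hxn)] at h1
  rw [← div_eq_inv_mul, le_div_iff₀ (hH.pos hz0)]
  rw [← div_eq_inv_mul, le_div_iff₀ hxn] at h1
  linarith

lemma contDiffAt (hH : IsFinslerNorm H) {x : EuclideanSpace ℝ (Fin N)} (hx : x ≠ 0) :
    ContDiffAt ℝ 2 H x :=
  hH.2.2.2.1.contDiffAt (isOpen_compl_singleton.mem_nhds hx)

lemma differentiableAt (hH : IsFinslerNorm H) {x : EuclideanSpace ℝ (Fin N)} (hx : x ≠ 0) :
    DifferentiableAt ℝ H x :=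
  (hH.contDiffAt hx).differentiableAt (by norm_num)

lemma gradient_zero (hH : IsFinslerNorm H) : gradient H 0 = 0 := by
  have h : fderiv ℝ H 0 = -fderiv ℝ H 0 := by
    conv_lhs => rw [show H = fun x => H (-x) from funext fun x => (hH.neg x).symm]
    simpa using fderiv_comp_smul (f := H) (x := 0) (-1 : ℝ)
  have h0 : fderiv ℝ H 0 = 0 := by
    have := add_eq_zero_iff_eq_neg.2 h
    rwa [← two_smul ℝ, smul_eq_zero_iff_right two_ne_zero] at this
  simp [gradient, h0]

lemma hasDerivAt_line (hH : IsFinslerNorm H) {x : EuclideanSpace ℝ (Fin N)} (hx : x ≠ 0)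
    (v : EuclideanSpace ℝ (Fin N)) :
    HasDerivAt (fun t : ℝ => H (x + t • v)) ⟪gradient H x, v⟫ 0 := by
  have h1 : HasDerivAt (fun t : ℝ => x + t • v) v 0 := by
    simpa using ((hasDerivAt_id (0 : ℝ)).smul_const v).const_add x
  have h2 : HasFDerivAt H (fderiv ℝ H x) (x + (0 : ℝ) • v) := by
    simpa using (hH.differentiableAt hx).hasFDerivAt
  rw [inner_gradient_left]
  exact h2.comp_hasDerivAt 0 h1

lemma inner_gradient_le (hH : IsFinslerNorm H) (x v : EuclideanSpace ℝ (Fin N)) :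
    ⟪gradient H x, v⟫ ≤ H v := by
  by_cases hx : x = 0
  · simp [hx, hH.gradient_zero, hH.nonneg]
  have h := (hH.hasDerivAt_line hx v).hasDerivWithinAt (s := Ioi 0)
  rw [hasDerivWithinAt_iff_tendsto_slope' (by simp)] at h
  refine le_of_tendsto h (eventually_nhdsWithin_of_forall fun t ht => ?_)
  have ht' : (0 : ℝ) < t := ht
  rw [slope_def_field, div_le_iff₀ (by simpa using ht')]
  have := hH.2.2.1 x (t • v)
  rw [hH.2.1, abs_of_pos ht'] at this
  simp only [zero_smul, add_zero, sub_zero]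
  linarith

lemma abs_inner_gradient_le (hH : IsFinslerNorm H) (x v : EuclideanSpace ℝ (Fin N)) :
    |⟪gradient H x, v⟫| ≤ H v := by
  refine abs_le.2 ⟨?_, hH.inner_gradient_le x v⟩
  have := hH.inner_gradient_le x (-v)
  rw [inner_neg_right, hH.neg] at this
  linarith

lemma norm_gradient_le (hH : IsFinslerNorm H) {C : ℝ} (hC : ∀ x, H x ≤ C * ‖x‖)
    (hC0 : 0 ≤ C) (x : EuclideanSpace ℝ (Fin N)) : ‖gradient H x‖ ≤ C := by
  have h := (hH.inner_gradient_le x (gradient H x)).trans (hC _)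
  rw [real_inner_self_eq_norm_sq] at h
  by_contra! hlt
  nlinarith [norm_nonneg (gradient H x)]

lemma inner_gradient_self (hH : IsFinslerNorm H) (x : EuclideanSpace ℝ (Fin N)) :
    ⟪gradient H x, x⟫ = H x := by
  by_cases hx : x = 0
  · simp [hx, hH.zero]
  refine (hH.hasDerivAt_line hx x).unique ?_
  have h : HasDerivAt (fun t : ℝ => (1 + t) * H x) (H x) 0 := by
    simpa using ((hasDerivAt_id (0 : ℝ)).const_add 1).mul_const (H x)
  refine h.congr_of_eventuallyEq ?_
  filter_upwards [Ioi_mem_nhds (show (-1 : ℝ) < 0 by norm_num)] with t ht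
  have ht' : (-1 : ℝ) < t := ht
  have : x + t • x = (1 + t) • x := by rw [add_smul, one_smul]
  rw [this, hH.2.1, abs_of_pos (by linarith)]

lemma gradient_smul (hH : IsFinslerNorm H) {c : ℝ} (hc : 0 < c)
    (x : EuclideanSpace ℝ (Fin N)) : gradient H (c • x) = gradient H x := by
  refine ext_inner_right ℝ fun v => ?_
  by_cases hx : x = 0
  · simp [hx]
  have hcx : c • x ≠ 0 := smul_ne_zero hc.ne' hx
  have h1 := hH.hasDerivAt_line hcx (c • v)
  have h2 := (hH.hasDerivAt_line hx v).const_mul c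
  have h3 : (fun t : ℝ => H (c • x + t • c • v)) = fun t : ℝ => c * H (x + t • v) := by
    funext t
    rw [← abs_of_pos hc, ← hH.2.1, abs_of_pos hc, smul_add, smul_comm t c v]
  rw [h3] at h1
  have h4 := h1.unique h2
  rw [inner_smul_right] at h4
  exact mul_left_cancel₀ hc.ne' h4

lemma gradient_differentiableAt_continuousAt (hH : IsFinslerNorm H)
    {x : EuclideanSpace ℝ (Fin N)} (hx : x ≠ 0) :
    DifferentiableAt ℝ (gradient H) x ∧ ContinuousAt (fderiv ℝ (gradient H)) x := by
  have h1 : ContDiffAt ℝ 1 (fderiv ℝ H) x := (hH.contDiffAt hx).fderiv_right (by norm_num)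
  have h2 : ContDiffAt ℝ 1 (gradient H) x :=
    ((InnerProductSpace.toDual ℝ (EuclideanSpace ℝ (Fin N))).symm.toContinuousLinearEquiv.contDiff
      (n := 1)).contDiffAt.comp x h1
  exact ⟨h2.differentiableAt one_ne_zero, (h2.fderiv_right (m := 0) (by norm_num)).continuousAt⟩

lemma hessian_smul (hH : IsFinslerNorm H) {c : ℝ} (hc : 0 < c)
    (x : EuclideanSpace ℝ (Fin N)) :
    c • fderiv ℝ (gradient H) (c • x) = fderiv ℝ (gradient H) x := by
  conv_rhs => rw [show gradient H = fun y => gradient H (c • y) from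
    funext fun y => (hH.gradient_smul hc y).symm]
  exact (fderiv_comp_smul (f := gradient H) (x := x) c).symm

lemma hessian_apply_self (hH : IsFinslerNorm H) {x : EuclideanSpace ℝ (Fin N)} (hx : x ≠ 0) :
    fderiv ℝ (gradient H) x x = 0 := by
  have h1 : HasDerivAt (fun t : ℝ => t • x) x 1 := by
    simpa using (hasDerivAt_id (1 : ℝ)).smul_const x
  have h2 : HasFDerivAt (gradient H) (fderiv ℝ (gradient H) x) ((1 : ℝ) • x) := by
    simpa using (hH.gradient_differentiableAt_continuousAt hx).1.hasFDerivAt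
  refine (h2.comp_hasDerivAt 1 h1).unique ((hasDerivAt_const 1 (gradient H x)).congr_of_eventuallyEq
    ?_)
  filter_upwards [Ioi_mem_nhds (show (0 : ℝ) < 1 by norm_num)] with t ht
  exact hH.gradient_smul ht x

lemma inner_hessian_self (hH : IsFinslerNorm H) {x : EuclideanSpace ℝ (Fin N)} (hx : x ≠ 0)
    (v : EuclideanSpace ℝ (Fin N)) : ⟪fderiv ℝ (gradient H) x v, x⟫ = 0 := by
  have h1 := ((hH.gradient_differentiableAt_continuousAt hx).1.hasFDerivAt.inner ℝ
    (hasFDerivAt_id x))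
  have h2 : (fun y => ⟪gradient H y, id y⟫) = H := funext fun y => hH.inner_gradient_self y
  rw [h2] at h1
  have h3 := congrArg (fun L => L v) (h1.unique (hH.differentiableAt hx).hasFDerivAt)
  simp only [ContinuousLinearMap.comp_apply, ContinuousLinearMap.prod_apply,
    fderivInnerCLM_apply, id, ContinuousLinearMap.id_apply, ← inner_gradient_left] at h3
  linarith

lemma inner_hessian_smul_add (hH : IsFinslerNorm H) {x : EuclideanSpace ℝ (Fin N)} (hx : x ≠ 0)
    (c : ℝ) (v : EuclideanSpace ℝ (Fin N)) :
    ⟪fderiv ℝ (gradient H) x (c • x + v), c • x + v⟫ = ⟪fderiv ℝ (gradient H) x v, v⟫ := by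
  rw [map_add, map_smul, hH.hessian_apply_self hx, smul_zero, zero_add, inner_add_right,
    inner_smul_right, hH.inner_hessian_self hx, mul_zero, zero_add]

lemma hessian_bound (hH : IsFinslerNorm H) :
    ∃ M : ℝ, 0 < M ∧ ∀ x v, H x * ⟪fderiv ℝ (gradient H) x v, v⟫ ≤ M * ‖v‖ ^ 2 := by
  obtain ⟨C, hC, hHC⟩ := hH.le_mul_norm
  have hcont : ContinuousOn (fderiv ℝ (gradient H))
      (Metric.sphere (0 : EuclideanSpace ℝ (Fin N)) 1) := fun x hx =>
    (hH.gradient_differentiableAt_continuousAt (by rintro rfl; simp at hx)).2.continuousWithinAt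
  obtain ⟨M, hM⟩ := (isCompact_sphere _ _).exists_bound_of_continuousOn hcont
  refine ⟨C * (|M| + 1), by positivity, fun x v => ?_⟩
  by_cases hx : x = 0
  · simp only [hx, hH.zero, zero_mul]
    positivity
  have hxn : 0 < ‖x‖ := norm_pos_iff.2 hx
  have h1 := hM (‖x‖⁻¹ • x) (by simp [norm_smul, hx])
  have h2 : fderiv ℝ (gradient H) (‖x‖⁻¹ • x) = ‖x‖ • fderiv ℝ (gradient H) x := by
    rw [← hH.hessian_smul (inv_pos.2 hxn) x, smul_smul, mul_inv_cancel₀ hxn.ne', one_smul]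
  rw [h2, norm_smul, norm_norm] at h1
  have h3 : ⟪fderiv ℝ (gradient H) x v, v⟫ ≤ ‖fderiv ℝ (gradient H) x‖ * ‖v‖ * ‖v‖ :=
    (real_inner_le_norm _ _).trans
      (mul_le_mul_of_nonneg_right (ContinuousLinearMap.le_opNorm _ _) (norm_nonneg _))
  calc H x * ⟪fderiv ℝ (gradient H) x v, v⟫
      ≤ H x * (‖fderiv ℝ (gradient H) x‖ * ‖v‖ * ‖v‖) :=
        mul_le_mul_of_nonneg_left h3 (hH.nonneg x)
    _ ≤ (C * ‖x‖) * (‖fderiv ℝ (gradient H) x‖ * ‖v‖ * ‖v‖) :=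
        mul_le_mul_of_nonneg_right (hHC x) (by positivity)
    _ = C * (‖x‖ * ‖fderiv ℝ (gradient H) x‖) * ‖v‖ ^ 2 := by ring
    _ ≤ C * (|M| + 1) * ‖v‖ ^ 2 := by
        gcongr
        linarith [le_abs_self M]

end IsFinslerNorm

end Finsler

section Profile

variable {B : ℝ → ℝ} {p γ Γ : ℝ}

namespace SatisfiesHB

lemma deriv_bounds (hB : SatisfiesHB B p 0 γ Γ) {t : ℝ} (ht : 0 ≤ t) :
    γ * t ^ (p - 1) ≤ deriv B t ∧ deriv B t ≤ Γ * t ^ (p - 1) := by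
  obtain ⟨-, -, h0, -, hp, -, -, -, -, hb, -⟩ := hB
  rcases ht.eq_or_lt with rfl | ht
  · simp [h0, Real.zero_rpow (by linarith : p - 1 ≠ 0)]
  have h : t ^ (p - 1) = t ^ (p - 2) * t := by
    rw [← Real.rpow_add_one ht.ne']
    congr 1
    ring
  have := hb t ht
  rw [zero_add] at this
  rw [h, ← mul_assoc, ← mul_assoc]
  exact this

lemma deriv_nonneg (hB : SatisfiesHB B p 0 γ Γ) {t : ℝ} (ht : 0 ≤ t) : 0 ≤ deriv B t := by
  have h := (hB.deriv_bounds ht).1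
  have : 0 ≤ γ * t ^ (p - 1) := mul_nonneg hB.2.2.2.2.2.2.2.1.le (Real.rpow_nonneg ht _)
  linarith

lemma gamma_le (hB : SatisfiesHB B p 0 γ Γ) : γ ≤ Γ := by
  have h := hB.deriv_bounds zero_le_one
  simp only [Real.one_rpow, mul_one] at h
  linarith

lemma contDiffOn_deriv (hB : SatisfiesHB B p 0 γ Γ) : ContDiffOn ℝ 1 (deriv B) (Ioi 0) :=
  ((contDiffOn_succ_iff_deriv_of_isOpen (n := 1) isOpen_Ioi).1
    (by simpa [one_add_one_eq_two] using hB.1)).2.2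

lemma continuous_deriv_abs (hB : SatisfiesHB B p 0 γ Γ) : Continuous fun t => deriv B |t| := by
  rw [continuous_iff_continuousAt]
  intro t
  by_cases ht : t = 0
  · subst ht
    have hp : 0 < p - 1 := by linarith [hB.2.2.2.2.1]
    have h1 : Filter.Tendsto (fun t : ℝ => Γ * |t| ^ (p - 1)) (nhds 0) (nhds 0) := by
      have : Continuous fun t : ℝ => Γ * |t| ^ (p - 1) :=
        continuous_const.mul (continuous_abs.rpow_const fun _ => Or.inr hp.le)
      simpa [Real.zero_rpow hp.ne'] using this.tendsto 0
    rw [ContinuousAt, abs_zero, hB.2.2.1]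
    exact squeeze_zero (fun t => hB.deriv_nonneg (abs_nonneg t))
      (fun t => (hB.deriv_bounds (abs_nonneg t)).2) h1
  · have h := (hB.contDiffOn_deriv.continuousOn).continuousAt (Ioi_mem_nhds (abs_pos.2 ht))
    exact ContinuousAt.comp (f := fun t : ℝ => |t|) (g := deriv B) h continuous_abs.continuousAt

lemma monotoneOn_deriv (hB : SatisfiesHB B p 0 γ Γ) : MonotoneOn (deriv B) (Ici 0) := by
  have hc : ContinuousOn (deriv B) (Ici 0) :=
    hB.continuous_deriv_abs.continuousOn.congr fun t ht => by
      simp only [abs_of_nonneg (mem_Ici.1 ht)]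
  refine monotoneOn_of_deriv_nonneg (convex_Ici 0) hc ?_ fun t ht => ?_
  · rw [interior_Ici]
    exact hB.contDiffOn_deriv.differentiableOn one_ne_zero
  · rw [interior_Ici] at ht
    exact (hB.2.2.2.1 t ht).2.2.le

/-- The primitive of `B'` vanishing at `0`; it differs from `B` by the jump of `B` at `0`. -/
lemma exists_primitive (hB : SatisfiesHB B p 0 γ Γ) :
    ∃ P : ℝ → ℝ, (∀ t, HasDerivAt P (deriv B |t|) t) ∧
      (∀ t, 0 ≤ t → 0 ≤ P t ∧ P t ≤ Γ / p * t ^ p) ∧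
      ∀ s t, 0 ≤ s → 0 ≤ t → deriv B s * (t - s) ≤ P t - P s := by
  have hp : 1 < p := hB.2.2.2.2.1
  have hd : ∀ t, HasDerivAt (fun t => ∫ s in (0 : ℝ)..t, deriv B |s|) (deriv B |t|) t := fun t =>
    intervalIntegral.integral_hasDerivAt_right (hB.continuous_deriv_abs.intervalIntegrable _ _)
      (hB.continuous_deriv_abs.stronglyMeasurableAtFilter _ _) hB.continuous_deriv_abs.continuousAt
  refine ⟨fun t => ∫ s in (0 : ℝ)..t, deriv B |s|, hd, fun t ht => ⟨?_, ?_⟩, fun s t hs ht => ?_⟩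
  · exact intervalIntegral.integral_nonneg ht fun s _ => hB.deriv_nonneg (abs_nonneg s)
  · calc ∫ s in (0 : ℝ)..t, deriv B |s| ≤ ∫ s in (0 : ℝ)..t, Γ * s ^ (p - 1) := by
          refine intervalIntegral.integral_mono_on ht
            (hB.continuous_deriv_abs.intervalIntegrable _ _) ?_ fun s hs => ?_
          · exact (intervalIntegral.intervalIntegrable_rpow' (by linarith)).const_mul _
          · rw [abs_of_nonneg hs.1]
            exact (hB.deriv_bounds hs.1).2
      _ = Γ / p * t ^ p := by
          rw [intervalIntegral.integral_const_mul, integral_rpow (Or.inl (by linarith)),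
            sub_add_cancel, Real.zero_rpow (by linarith)]
          ring
  · have hint : ∀ a b, IntervalIntegrable (fun s => deriv B |s|) volume a b := fun a b =>
      hB.continuous_deriv_abs.intervalIntegrable _ _
    rw [intervalIntegral.integral_interval_sub_left (hint _ _) (hint _ _)]
    rcases le_total s t with hst | hst
    · have := intervalIntegral.integral_mono_on hst (intervalIntegrable_const (c := deriv B s))
        (hint s t) fun x hx => by
          rw [abs_of_nonneg (hs.trans hx.1)]
          exact hB.monotoneOn_deriv hs (hs.trans hx.1) hx.1
      rw [intervalIntegral.integral_const, smul_eq_mul] at this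
      linarith
    · have := intervalIntegral.integral_mono_on hst (hint t s)
        (intervalIntegrable_const (c := deriv B s)) fun x hx => by
          rw [abs_of_nonneg (ht.trans hx.1)]
          exact hB.monotoneOn_deriv (ht.trans hx.1) hs hx.2
      rw [intervalIntegral.integral_const, smul_eq_mul] at this
      rw [intervalIntegral.integral_symm]
      linarith

end SatisfiesHB

end Profile

section Young

lemma rpow_sub_one_eq_mul {p h : ℝ} (hp : 2 ≤ p) (hh : 0 ≤ h) :
    h ^ (p - 1) = h ^ (p - 2) * h := by
  rcases hh.eq_or_lt with rfl | hh
  · rw [mul_zero, Real.zero_rpow (by linarith)]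
  · rw [← Real.rpow_add_one hh.ne']
    congr 1
    ring

lemma rpow_eq_mul_sq {p h : ℝ} (hp : 2 ≤ p) (hh : 0 ≤ h) :
    h ^ p = h ^ (p - 2) * h ^ 2 := by
  rcases hh.eq_or_lt with rfl | hh
  · rw [Real.zero_rpow (by linarith)]
    ring
  · rw [← Real.rpow_natCast, ← Real.rpow_add hh]
    norm_num

lemma abs_rpow_sub_one_mul {q : ℝ} (hq : 1 < q) (v : ℝ) :
    |v| ^ (q - 1) * v * v = |v| ^ (q + 1) := by
  rw [mul_assoc, ← sq, ← sq_abs, rpow_eq_mul_sq (p := q + 1) (by linarith) (abs_nonneg v)]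
  congr 2
  ring

lemma mul_le_eps_mul_sq_add {a b ε : ℝ} (hε : 0 < ε) :
    a * b ≤ ε * a ^ 2 + 1 / (4 * ε) * b ^ 2 := by
  have h2 : 0 ≤ ε * (a - b / (2 * ε)) ^ 2 := by positivity
  have h3 : ε * (a - b / (2 * ε)) ^ 2 = ε * a ^ 2 + 1 / (4 * ε) * b ^ 2 - a * b := by
    field_simp
    ring
  linarith

lemma rpow_mul_rpow_mul_rpow_le_add {w₁ w₂ w₃ a b c : ℝ} (hw₁ : 0 ≤ w₁) (hw₂ : 0 ≤ w₂)
    (hw₃ : 0 ≤ w₃) (hw : w₁ + w₂ + w₃ = 1) (ha : 0 ≤ a) (hb : 0 ≤ b) (hc : 0 ≤ c) :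
    a ^ w₁ * b ^ w₂ * c ^ w₃ ≤ a + b + c := by
  have := Real.geom_mean_le_arith_mean3_weighted hw₁ hw₂ hw₃ ha hb hc hw
  have h1 : w₁ * a ≤ a := mul_le_of_le_one_left ha (by linarith)
  have h2 : w₂ * b ≤ b := mul_le_of_le_one_left hb (by linarith)
  have h3 : w₃ * c ≤ c := mul_le_of_le_one_left hc (by linarith)
  linarith

/-- Young's inequality with exponents `p / (p - 1)`, `r` and `s = (1 / p - 1 / r)⁻¹`. -/
lemma rpow_sub_one_mul_mul_le {p r s h v d : ℝ} (hp : 2 ≤ p) (hr : 0 < r) (hs : 0 < s)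
    (hprs : 1 / s = 1 / p - 1 / r) (hh : 0 ≤ h) (hv : 0 ≤ v) (hd : 0 ≤ d) :
    h ^ (p - 1) * (v * d) ≤ h ^ p + v ^ r + d ^ s := by
  have hp0 : 0 < p := by linarith
  have key := rpow_mul_rpow_mul_rpow_le_add (w₁ := (p - 1) / p) (w₂ := 1 / r) (w₃ := 1 / s)
    (div_nonneg (by linarith) hp0.le) (by positivity) (by positivity)
    (by rw [hprs]; field_simp; ring)
    (Real.rpow_nonneg hh p) (Real.rpow_nonneg hv r) (Real.rpow_nonneg hd s)
  rw [← Real.rpow_mul hh, ← Real.rpow_mul hv, ← Real.rpow_mul hd, mul_one_div_cancel hr.ne',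
    mul_one_div_cancel hs.ne', mul_div_cancel₀ _ hp0.ne', Real.rpow_one, Real.rpow_one] at key
  linarith

/-- Absorption of the gradient of the power `y ^ k` of a cut-off `y`. -/
lemma exists_rpow_mul_sq_le {p r s ε : ℝ} {k : ℕ} (hp : 2 ≤ p) (hr : 0 < r) (hs : 0 < s)
    (hprs : 1 / s = 1 / p - 1 / r) (hε : 0 < ε) (hk : 1 ≤ k) (hks : s / 2 ≤ k) :
    ∃ C : ℝ, 0 ≤ C ∧ ∀ h v y d : ℝ, 0 ≤ h → 0 ≤ v → 0 ≤ y → y ≤ 1 → 0 ≤ d →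
      h ^ (p - 2) * (v * (k * y ^ (k - 1) * d)) ^ 2 ≤
        ε * ((h ^ p + v ^ r) * (y ^ k) ^ 2) + C * d ^ s := by
  have hp0 : 0 < p := by linarith
  set w : ℝ := (p - 2) / p + 2 / r with hwdef
  have hw1 : 0 ≤ (p - 2) / p := div_nonneg (by linarith) hp0.le
  have hw0 : 0 ≤ w := by positivity
  have hsum : (p - 2) / p + 2 / r + 2 / s = 1 := by
    have : 2 / s = 2 * (1 / s) := by ring
    rw [this, hprs]
    field_simp
    ring
  have hεw : 0 < ε ^ w := Real.rpow_pos_of_pos hε _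
  refine ⟨((k : ℝ) ^ 2 / ε ^ w) ^ (s / 2), by positivity, fun h v y d hh hv hy hy1 hd => ?_⟩
  have hyk : (0 : ℝ) ≤ (y ^ k) ^ 2 := by positivity
  have key := rpow_mul_rpow_mul_rpow_le_add (w₁ := (p - 2) / p) (w₂ := 2 / r) (w₃ := 2 / s)
    (a := ε * (h ^ p * (y ^ k) ^ 2)) (b := ε * (v ^ r * (y ^ k) ^ 2))
    (c := ((k : ℝ) ^ 2 / ε ^ w) ^ (s / 2) * d ^ s) hw1 (by positivity) (by positivity) hsum
    (by positivity) (by positivity) (by positivity)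
  have e1 : (ε * (h ^ p * (y ^ k) ^ 2)) ^ ((p - 2) / p) =
      ε ^ ((p - 2) / p) * (h ^ (p - 2) * ((y ^ k) ^ 2) ^ ((p - 2) / p)) := by
    rw [Real.mul_rpow hε.le (by positivity), Real.mul_rpow (by positivity) hyk,
      ← Real.rpow_mul hh, mul_div_cancel₀ _ hp0.ne']
  have e2 : (ε * (v ^ r * (y ^ k) ^ 2)) ^ (2 / r) =
      ε ^ (2 / r) * (v ^ 2 * ((y ^ k) ^ 2) ^ (2 / r)) := by
    rw [Real.mul_rpow hε.le (by positivity), Real.mul_rpow (by positivity) hyk,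
      ← Real.rpow_mul hv, mul_div_cancel₀ _ hr.ne', Real.rpow_two]
  have e3 : (((k : ℝ) ^ 2 / ε ^ w) ^ (s / 2) * d ^ s) ^ (2 / s) =
      (k : ℝ) ^ 2 / ε ^ w * d ^ 2 := by
    rw [Real.mul_rpow (by positivity) (by positivity), ← Real.rpow_mul (by positivity),
      ← Real.rpow_mul hd, mul_div_cancel₀ _ hs.ne', Real.rpow_two,
      show s / 2 * (2 / s) = 1 by field_simp, Real.rpow_one]
  have e4 : ε ^ ((p - 2) / p) * ε ^ (2 / r) = ε ^ w := (Real.rpow_add hε _ _).symm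
  have e5 : ((y ^ k) ^ 2) ^ ((p - 2) / p) * ((y ^ k) ^ 2) ^ (2 / r) = y ^ (2 * k * w) := by
    rw [← Real.rpow_add_of_nonneg hyk hw1 (by positivity), ← pow_mul, ← Real.rpow_natCast,
      ← Real.rpow_mul hy]
    push_cast
    rw [mul_comm (k : ℝ) 2]
  have e6 : (y ^ (k - 1)) ^ 2 ≤ y ^ (2 * k * w) := by
    rw [← pow_mul, ← Real.rpow_natCast]
    refine Real.rpow_le_rpow_of_exponent_ge' hy hy1 (by positivity) ?_
    have hw' : w = 1 - 2 / s := by linarith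
    have h1 : 1 ≤ (k : ℝ) * (2 / s) := by
      rw [mul_div_assoc', le_div_iff₀ hs]
      linarith
    rw [hw']
    push_cast [Nat.cast_sub hk]
    linarith
  have e7 : (ε * (h ^ p * (y ^ k) ^ 2)) ^ ((p - 2) / p) *
      (ε * (v ^ r * (y ^ k) ^ 2)) ^ (2 / r) *
      (((k : ℝ) ^ 2 / ε ^ w) ^ (s / 2) * d ^ s) ^ (2 / s) =
      h ^ (p - 2) * v ^ 2 * (k : ℝ) ^ 2 * d ^ 2 * y ^ (2 * k * w) := by
    rw [e1, e2, e3, ← e5]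
    calc _ = (ε ^ ((p - 2) / p) * ε ^ (2 / r)) / ε ^ w * (h ^ (p - 2) * v ^ 2 * (k : ℝ) ^ 2 * d ^ 2 *
          (((y ^ k) ^ 2) ^ ((p - 2) / p) * ((y ^ k) ^ 2) ^ (2 / r))) := by ring
      _ = _ := by rw [e4, div_self hεw.ne', one_mul]
  rw [e7] at key
  calc h ^ (p - 2) * (v * (k * y ^ (k - 1) * d)) ^ 2
      = h ^ (p - 2) * v ^ 2 * (k : ℝ) ^ 2 * d ^ 2 * (y ^ (k - 1)) ^ 2 := by ring
    _ ≤ h ^ (p - 2) * v ^ 2 * (k : ℝ) ^ 2 * d ^ 2 * y ^ (2 * k * w) :=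
        mul_le_mul_of_nonneg_left e6 (by positivity)
    _ ≤ _ := by linarith

lemma norm_mul_norm_le_mul_rpow {F : Type*} [NormedAddCommGroup F] {v w : F} {p h c c' : ℝ}
    (hp : 2 ≤ p) (hh : 0 ≤ h) (hc : 0 ≤ c) (hv : ‖v‖ ≤ c * h ^ (p - 1)) (hw : ‖w‖ ≤ c' * h) :
    ‖v‖ * ‖w‖ ≤ c * c' * h ^ p := by
  have hpow := Real.rpow_nonneg hh (p - 1)
  calc ‖v‖ * ‖w‖ ≤ c * h ^ (p - 1) * (c' * h) :=
        mul_le_mul hv hw (norm_nonneg _) (mul_nonneg hc hpow)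
    _ = c * c' * h ^ p := by
      rw [rpow_sub_one_eq_mul hp hh, rpow_eq_mul_sq hp hh]
      ring

end Young

section Calculus

variable {E : Type*} [NormedAddCommGroup E] [InnerProductSpace ℝ E] [FiniteDimensional ℝ E]

lemma continuous_gradient {f : E → ℝ} (hf : ContDiff ℝ 1 f) : Continuous (gradient f) :=
  (InnerProductSpace.toDual ℝ E).symm.continuous.comp (hf.continuous_fderiv one_ne_zero)

lemma gradient_fun_mul {f g : E → ℝ} {x : E} (hf : DifferentiableAt ℝ f x)
    (hg : DifferentiableAt ℝ g x) :
    gradient (fun y => f y * g y) x = f x • gradient g x + g x • gradient f x := by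
  simp only [gradient, fderiv_fun_mul hf hg, map_add, map_smul]

lemma gradient_fun_sub {f g : E → ℝ} {x : E} (hf : DifferentiableAt ℝ f x)
    (hg : DifferentiableAt ℝ g x) :
    gradient (fun y => f y - g y) x = gradient f x - gradient g x := by
  simp only [gradient, fderiv_fun_sub hf hg, map_sub]

lemma gradient_comp_smul (f : E → ℝ) (c : ℝ) (x : E) :
    gradient (fun y => f (c • y)) x = c • gradient f (c • x) := by
  simp only [gradient, fderiv_comp_smul, map_smul]

lemma gradient_fun_pow {f : E → ℝ} {x : E} (hf : DifferentiableAt ℝ f x) (k : ℕ) :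
    gradient (fun y => f y ^ k) x = (k * f x ^ (k - 1)) • gradient f x := by
  simp [gradient, fderiv_fun_pow k hf]

lemma gradient_eq_zero_of_notMem_tsupport {f : E → ℝ} {x : E} (hx : x ∉ tsupport f) :
    gradient f x = 0 := by
  simp [gradient, fderiv_of_notMem_tsupport (𝕜 := ℝ) hx]

lemma gradient_eq_zero_of_eqOn_one {f : E → ℝ} {s : Set E} (hs : IsOpen s)
    (hf : ∀ x ∈ s, f x = 1) {x : E} (hx : x ∈ s) : gradient f x = 0 := by
  have : f =ᶠ[nhds x] fun _ => 1 := by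
    filter_upwards [hs.mem_nhds hx] with y hy using hf y hy
  simp [gradient, this.fderiv_eq]

variable [MeasurableSpace E] [BorelSpace E]

lemma integrable_of_eq_zero_of_notMem_tsupport {f ψ : E → ℝ} (hf : Continuous f)
    (hψ : HasCompactSupport ψ) (h : ∀ x, ψ x = 0 → gradient ψ x = 0 → f x = 0) :
    Integrable f :=
  hf.integrable_of_hasCompactSupport <| HasCompactSupport.intro hψ fun x hx =>
    h x (image_eq_zero_of_notMem_tsupport hx) (gradient_eq_zero_of_notMem_tsupport hx)

end Calculus

section Energy

variable {E : Type*} [NormedAddCommGroup E] [InnerProductSpace ℝ E] [FiniteDimensional ℝ E]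
  [MeasurableSpace E] [BorelSpace E]

/-- Testing the equation with `u ψ`. -/
lemma integral_inner_gradient_mul_add {u ψ : E → ℝ} {V : E → E} {q : ℝ} (hq : 1 < q)
    (hu : ContDiff ℝ 1 u) (hV : Continuous V)
    (hweak : ∀ φ : E → ℝ, ContDiff ℝ 1 φ → HasCompactSupport φ →
      ∫ x, ⟪V x, gradient φ x⟫ = ∫ x, |u x| ^ (q - 1) * u x * φ x)
    (hψ : ContDiff ℝ 1 ψ) (hψc : HasCompactSupport ψ) :
    (∫ x, ⟪V x, gradient u x⟫ * ψ x) + ∫ x, u x * ⟪V x, gradient ψ x⟫ =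
      ∫ x, |u x| ^ (q + 1) * ψ x := by
  have h := hweak (fun x => u x * ψ x) (hu.mul hψ) hψc.mul_left
  have hgu := continuous_gradient hu
  have hgψ := continuous_gradient hψ
  rw [← integral_add]
  · have e1 : ∀ x, ⟪V x, gradient (fun x => u x * ψ x) x⟫ =
        ⟪V x, gradient u x⟫ * ψ x + u x * ⟪V x, gradient ψ x⟫ := fun x => by
      rw [gradient_fun_mul (hu.differentiable one_ne_zero x) (hψ.differentiable one_ne_zero x),
        inner_add_right, inner_smul_right, inner_smul_right]
      ring
    have e2 : ∀ x, |u x| ^ (q - 1) * u x * (u x * ψ x) = |u x| ^ (q + 1) * ψ x := fun x => by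
      rw [← abs_rpow_sub_one_mul hq]
      ring
    simpa only [e1, e2] using h
  · exact integrable_of_eq_zero_of_notMem_tsupport ((hV.inner hgu).mul hψ.continuous) hψc
      fun x h1 _ => by rw [h1, mul_zero]
  · exact integrable_of_eq_zero_of_notMem_tsupport (hu.continuous.mul (hV.inner hgψ)) hψc
      fun x _ h2 => by rw [h2, inner_zero_right, mul_zero]

/-- Energy estimate obtained by combining the equation tested with `u ψ ^ 2` and stability. -/
lemma exists_energy_le {u h : E → ℝ} {V : E → E} {S : Set E} {p q A c γ : ℝ} (hp : 2 ≤ p)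
    (hq : 1 < q) (hA : 0 < A) (hAq : A < q * γ)
    (hu : ContDiff ℝ 1 u) (hh : Continuous h) (hh0 : ∀ x, 0 ≤ h x) (hV : Continuous V)
    (hVle : ∀ x, ‖V x‖ ≤ c * h x ^ (p - 1))
    (hVu : ∀ x, γ * h x ^ p ≤ ⟪V x, gradient u x⟫)
    (hweak : ∀ φ : E → ℝ, ContDiff ℝ 1 φ → HasCompactSupport φ →
      ∫ x, ⟪V x, gradient φ x⟫ = ∫ x, |u x| ^ (q - 1) * u x * φ x)
    (hstab : ∀ ε : ℝ, 0 < ε → ∃ C : ℝ, 0 ≤ C ∧ ∀ ψ : E → ℝ, ContDiff ℝ 1 ψ →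
      HasCompactSupport ψ → tsupport ψ ⊆ S →
      q * ∫ x, |u x| ^ (q + 1) * ψ x ^ 2 ≤ (1 + ε) * A * (∫ x, h x ^ p * ψ x ^ 2) +
        C * ∫ x, h x ^ (p - 2) * (u x * ‖gradient ψ x‖) ^ 2) :
    ∃ C : ℝ, 0 ≤ C ∧ ∀ ψ : E → ℝ, ContDiff ℝ 1 ψ → HasCompactSupport ψ → tsupport ψ ⊆ S →
      ∫ x, (h x ^ p + |u x| ^ (q + 1)) * ψ x ^ 2 ≤
        C * ∫ x, h x ^ (p - 2) * (u x * ‖gradient ψ x‖) ^ 2 := by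
  have hp0 : 0 ≤ p - 2 := by linarith
  obtain ⟨ε, hε, hεA⟩ : ∃ ε : ℝ, 0 < ε ∧ (1 + ε) * A < q * (γ - ε) := by
    refine ⟨(q * γ - A) / (2 * (A + q)), by apply div_pos <;> linarith, ?_⟩
    have : (q * γ - A) / (2 * (A + q)) * (A + q) = (q * γ - A) / 2 := by
      field_simp
    nlinarith
  obtain ⟨C₁, hC₁, hS⟩ := hstab ε hε
  set g : ℝ := q * (γ - ε) - (1 + ε) * A with hg
  have hg0 : 0 < g := by linarith
  set C₂ : ℝ := 1 / (4 * ε) * (2 * c) ^ 2 with hC₂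
  have hC₂0 : 0 ≤ C₂ := by positivity
  set C₃ : ℝ := (C₁ + q * C₂) / g with hC₃
  have hC₃0 : 0 ≤ C₃ := by positivity
  refine ⟨C₃ + ((1 + ε) * A * C₃ + C₁) / q, by positivity, fun ψ hψ hψc hψS => ?_⟩
  have hgu := continuous_gradient hu
  have hgψ := continuous_gradient hψ
  have chp : Continuous fun x => h x ^ p := hh.rpow_const fun _ => Or.inr (by linarith)
  have chp2 : Continuous fun x => h x ^ (p - 2) := hh.rpow_const fun _ => Or.inr hp0
  have cuq : Continuous fun x => |u x| ^ (q + 1) :=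
    hu.continuous.abs.rpow_const fun _ => Or.inr (by linarith)
  have iX : Integrable fun x => h x ^ p * ψ x ^ 2 :=
    integrable_of_eq_zero_of_notMem_tsupport (chp.mul (hψ.continuous.pow 2)) hψc
      fun x h1 _ => by simp [h1]
  have iY : Integrable fun x => |u x| ^ (q + 1) * ψ x ^ 2 :=
    integrable_of_eq_zero_of_notMem_tsupport (cuq.mul (hψ.continuous.pow 2)) hψc
      fun x h1 _ => by simp [h1]
  have iZ : Integrable fun x => h x ^ (p - 2) * (u x * ‖gradient ψ x‖) ^ 2 :=
    integrable_of_eq_zero_of_notMem_tsupport (chp2.mul ((hu.continuous.mul hgψ.norm).pow 2)) hψc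
      fun x _ h2 => by simp [h2]
  have hψ2 : ContDiff ℝ 1 fun x => ψ x ^ 2 := hψ.pow 2
  have hψ2c : HasCompactSupport fun x => ψ x ^ 2 :=
    HasCompactSupport.intro hψc fun x hx => by
      rw [image_eq_zero_of_notMem_tsupport hx]
      norm_num
  have hgψ2 : ∀ x, gradient (fun x => ψ x ^ 2) x = (2 * ψ x) • gradient ψ x := fun x => by
    rw [gradient_fun_pow (hψ.differentiable one_ne_zero x)]
    simp
  have hW := integral_inner_gradient_mul_add hq hu hV hweak hψ2 hψ2c
  have iW1 : Integrable fun x => ⟪V x, gradient u x⟫ * ψ x ^ 2 :=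
    integrable_of_eq_zero_of_notMem_tsupport ((hV.inner hgu).mul (hψ.continuous.pow 2)) hψc
      fun x h1 _ => by simp [h1]
  have iW2 : Integrable fun x => u x * ⟪V x, gradient (fun x => ψ x ^ 2) x⟫ :=
    integrable_of_eq_zero_of_notMem_tsupport
      (hu.continuous.mul (hV.inner (continuous_gradient hψ2))) hψc
      fun x h1 h2 => by simp [hgψ2, h1]
  have hXW : γ * ∫ x, h x ^ p * ψ x ^ 2 ≤ ∫ x, ⟪V x, gradient u x⟫ * ψ x ^ 2 := by
    rw [← integral_const_mul]
    refine integral_mono (iX.const_mul _) iW1 fun x => ?_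
    simp only
    rw [← mul_assoc]
    exact mul_le_mul_of_nonneg_right (hVu x) (sq_nonneg _)
  have hcross : -(ε * (∫ x, h x ^ p * ψ x ^ 2) +
      C₂ * ∫ x, h x ^ (p - 2) * (u x * ‖gradient ψ x‖) ^ 2) ≤
      ∫ x, u x * ⟪V x, gradient (fun x => ψ x ^ 2) x⟫ := by
    rw [← integral_const_mul, ← integral_const_mul,
      ← integral_add (iX.const_mul _) (iZ.const_mul _), ← integral_neg]
    refine integral_mono ((iX.const_mul _).add (iZ.const_mul _)).neg iW2 fun x => ?_
    simp only
    rw [hgψ2, inner_smul_right]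
    have h1 : |⟪V x, gradient ψ x⟫| ≤ c * h x ^ (p - 1) * ‖gradient ψ x‖ :=
      (abs_real_inner_le_norm _ _).trans (mul_le_mul_of_nonneg_right (hVle x) (norm_nonneg _))
    have h2 := mul_le_eps_mul_sq_add (a := h x * |ψ x|) (b := 2 * c * (|u x| * ‖gradient ψ x‖)) hε
    have h3 : |u x * (2 * ψ x * ⟪V x, gradient ψ x⟫)| ≤
        |u x| * (2 * |ψ x| * (c * h x ^ (p - 1) * ‖gradient ψ x‖)) := by
      rw [abs_mul, abs_mul, abs_mul, abs_two]
      gcongr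
    refine (abs_le.1 (h3.trans ?_)).1
    rw [rpow_sub_one_eq_mul hp (hh0 x), rpow_eq_mul_sq hp (hh0 x), hC₂]
    have h4 := mul_le_mul_of_nonneg_left h2 (Real.rpow_nonneg (hh0 x) (p - 2))
    simp only [mul_pow, sq_abs] at h4 ⊢
    linarith
  have hSψ := hS ψ hψ hψc hψS
  set X := ∫ x, h x ^ p * ψ x ^ 2
  set Y := ∫ x, |u x| ^ (q + 1) * ψ x ^ 2
  set Z := ∫ x, h x ^ (p - 2) * (u x * ‖gradient ψ x‖) ^ 2
  have hXY : (γ - ε) * X ≤ Y + C₂ * Z := by linarith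
  have hX : X ≤ C₃ * Z := by
    rw [hC₃, div_mul_eq_mul_div, le_div_iff₀ hg0, hg]
    have := mul_le_mul_of_nonneg_left hXY (by linarith : 0 ≤ q)
    linarith
  have hY : Y ≤ ((1 + ε) * A * C₃ + C₁) / q * Z := by
    rw [div_mul_eq_mul_div, le_div_iff₀ (by linarith)]
    have := mul_le_mul_of_nonneg_left hX (by positivity : 0 ≤ (1 + ε) * A)
    linarith
  have hsum : ∫ x, (h x ^ p + |u x| ^ (q + 1)) * ψ x ^ 2 = X + Y := by
    simp only [add_mul]
    exact integral_add iX iY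
  rw [hsum]
  linarith

end Energy

section Integrability

variable {E : Type*} [NormedAddCommGroup E] [InnerProductSpace ℝ E] [FiniteDimensional ℝ E]

/-- A sequence of cut-off functions exhausting the space, with gradients of the size `1 / ‖x‖`. -/
structure IsCutoffSeq (χ : ℕ → E → ℝ) (M : ℝ) : Prop where
  contDiff : ∀ n, ContDiff ℝ 1 (χ n)
  hasCompactSupport : ∀ n, HasCompactSupport (χ n)
  nonneg : ∀ n x, 0 ≤ χ n x
  le_one : ∀ n x, χ n x ≤ 1
  eq_one : ∀ n : ℕ, ∀ x ∈ Metric.ball (0 : E) (n + 1), χ n x = 1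
  norm_gradient_mul_le : ∀ n x, ‖gradient (χ n) x‖ * (1 + ‖x‖) ≤ M

lemma exists_isCutoffSeq (E : Type*) [NormedAddCommGroup E] [InnerProductSpace ℝ E]
    [FiniteDimensional ℝ E] : ∃ (χ : ℕ → E → ℝ) (M : ℝ), IsCutoffSeq χ M := by
  let f : ContDiffBump (0 : E) := ⟨1, 2, one_pos, one_lt_two⟩
  have hf : ContDiff ℝ 1 f := f.contDiff
  have hfc : HasCompactSupport f := f.hasCompactSupport
  have hgc : HasCompactSupport fun y => ‖gradient f y‖ * (1 + ‖y‖) :=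
    HasCompactSupport.intro hfc fun x hx => by simp [gradient_eq_zero_of_notMem_tsupport hx]
  obtain ⟨M, hM⟩ := hgc.exists_bound_of_continuous
    ((continuous_gradient hf).norm.mul (continuous_const.add continuous_norm))
  have hn : ∀ n : ℕ, (0 : ℝ) < n + 1 := fun n => by positivity
  refine ⟨fun n x => f (((n : ℝ) + 1)⁻¹ • x), M, ⟨fun n => hf.comp (contDiff_const_smul _),
    fun n => hfc.comp_smul (inv_ne_zero (hn n).ne'), fun n x => f.nonneg, fun n x => f.le_one,
    fun n x hx => f.one_of_mem_closedBall ?_, fun n x => ?_⟩⟩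
  · rw [mem_closedBall_zero_iff, norm_smul, norm_inv, Real.norm_of_nonneg (hn n).le,
      inv_mul_le_iff₀ (hn n)]
    simpa [f] using (mem_ball_zero_iff.1 hx).le
  · have hy := (le_abs_self _).trans (hM (((n : ℝ) + 1)⁻¹ • x))
    rw [gradient_comp_smul, norm_smul, norm_inv, Real.norm_of_nonneg (hn n).le]
    refine le_trans ?_ hy
    rw [norm_smul (((n : ℝ) + 1)⁻¹) x, norm_inv, Real.norm_of_nonneg (hn n).le]
    have h1 : ((n : ℝ) + 1)⁻¹ ≤ 1 := inv_le_one_of_one_le₀ (by linarith [n.cast_nonneg (α := ℝ)])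
    have h2 : 0 ≤ ‖gradient f (((n : ℝ) + 1)⁻¹ • x)‖ := norm_nonneg _
    nlinarith [norm_nonneg x]

namespace IsCutoffSeq

variable {χ : ℕ → E → ℝ} {M : ℝ}

lemma bound_nonneg (hχ : IsCutoffSeq χ M) : 0 ≤ M :=
  (by positivity : 0 ≤ ‖gradient (χ 0) 0‖ * (1 + ‖(0 : E)‖)).trans (hχ.norm_gradient_mul_le 0 0)

lemma norm_gradient_le (hχ : IsCutoffSeq χ M) (n : ℕ) (x : E) :
    ‖gradient (χ n) x‖ ≤ M * (1 + ‖x‖)⁻¹ := by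
  rw [← div_eq_mul_inv, le_div_iff₀ (by positivity)]
  exact hχ.norm_gradient_mul_le n x

lemma eventually_eq (hχ : IsCutoffSeq χ M) (x : E) :
    ∀ᶠ n in Filter.atTop, χ n x = 1 ∧ gradient (χ n) x = 0 := by
  obtain ⟨m, hm⟩ := exists_nat_gt ‖x‖
  filter_upwards [Filter.eventually_ge_atTop m] with n hn
  have hx : x ∈ Metric.ball (0 : E) (n + 1) := by
    rw [mem_ball_zero_iff]
    have : (m : ℝ) ≤ n := by exact_mod_cast hn
    linarith
  exact ⟨hχ.eq_one n x hx, gradient_eq_zero_of_eqOn_one Metric.isOpen_ball (hχ.eq_one n) hx⟩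

end IsCutoffSeq

variable [MeasurableSpace E] [BorelSpace E]

lemma integrable_of_energy_le {u h : E → ℝ} {K : Set E} {p r s : ℝ} (hp : 2 ≤ p) (hr : 0 < r)
    (hs : 0 < s) (hprs : 1 / s = 1 / p - 1 / r) (hEs : (Module.finrank ℝ E : ℝ) < s)
    (hu : Continuous u) (hh : Continuous h) (hh0 : ∀ x, 0 ≤ h x) (hK : IsCompact K)
    (hen : ∃ C : ℝ, 0 ≤ C ∧ ∀ ψ : E → ℝ, ContDiff ℝ 1 ψ → HasCompactSupport ψ → tsupport ψ ⊆ Kᶜ →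
      ∫ x, (h x ^ p + |u x| ^ r) * ψ x ^ 2 ≤
        C * ∫ x, h x ^ (p - 2) * (u x * ‖gradient ψ x‖) ^ 2) :
    Integrable fun x => h x ^ p + |u x| ^ r := by
  obtain ⟨C, hC, hen⟩ := hen
  obtain ⟨χ, M, hχ⟩ := exists_isCutoffSeq E
  obtain ⟨m, hm⟩ : ∃ m : ℕ, K ⊆ Metric.ball 0 ((m : ℝ) + 1) := by
    obtain ⟨R, hR⟩ := hK.isBounded.subset_ball (0 : E)
    obtain ⟨m, hm⟩ := exists_nat_gt R
    exact ⟨m, hR.trans (Metric.ball_subset_ball (by linarith))⟩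
  obtain ⟨k, hk⟩ := exists_nat_ge (max 1 (s / 2))
  have hk1 : 1 ≤ k := by exact_mod_cast (le_max_left _ _).trans hk
  obtain ⟨C', hC', hY⟩ := exists_rpow_mul_sq_le (ε := 1 / (2 * (C + 1))) hp hr hs hprs
    (by positivity) hk1 ((le_max_right _ _).trans hk)
  set F : E → ℝ := fun x => h x ^ p + |u x| ^ r with hF
  have hF0 : ∀ x, 0 ≤ F x := fun x =>
    add_nonneg (Real.rpow_nonneg (hh0 x) _) (Real.rpow_nonneg (abs_nonneg _) _)
  have hFc : Continuous F := (hh.rpow_const fun _ => Or.inr (by linarith)).add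
    (hu.abs.rpow_const fun _ => Or.inr hr.le)
  set ζ : E → ℝ := fun x => 1 - χ m x with hζ
  have hζ1 : ContDiff ℝ 1 ζ := contDiff_const.sub (hχ.contDiff m)
  have hζ0 : ∀ x, 0 ≤ ζ x ∧ ζ x ≤ 1 := fun x =>
    ⟨sub_nonneg.2 (hχ.le_one m x), by simp only [hζ]; linarith [hχ.nonneg m x]⟩
  have hgζ : ∀ x, gradient ζ x = -gradient (χ m) x := fun x => by
    rw [hζ, gradient_fun_sub (differentiableAt_const _)
      ((hχ.contDiff m).differentiable one_ne_zero x)]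
    simp [gradient]
  have hint := integrable_one_add_norm (E := E) (μ := volume) hEs
  have key : ∀ n, ∫ x, F x * (((χ n x) * ζ x) ^ k) ^ 2 ≤
      2 * (C * C' * ((2 * M) ^ s * ∫ x : E, (1 + ‖x‖) ^ (-s))) := by
    intro n
    set η : E → ℝ := fun x => χ n x * ζ x with hη
    have hη1 : ContDiff ℝ 1 η := (hχ.contDiff n).mul hζ1
    have hηc : HasCompactSupport η := (hχ.hasCompactSupport n).mul_right
    have hη0 : ∀ x, 0 ≤ η x := fun x => mul_nonneg (hχ.nonneg n x) (hζ0 x).1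
    have hη2 : ∀ x, η x ≤ 1 := fun x =>
      mul_le_one₀ (hχ.le_one n x) (hζ0 x).1 (hζ0 x).2
    have hgη : ∀ x, ‖gradient η x‖ ≤ 2 * M * (1 + ‖x‖)⁻¹ := fun x => by
      rw [hη, gradient_fun_mul ((hχ.contDiff n).differentiable one_ne_zero x)
        (hζ1.differentiable one_ne_zero x), hgζ]
      refine (norm_add_le _ _).trans ?_
      rw [norm_smul, norm_smul, norm_neg, Real.norm_of_nonneg (hχ.nonneg n x),
        Real.norm_of_nonneg (hζ0 x).1]
      have h1 := mul_le_mul (hχ.le_one n x) (hχ.norm_gradient_le m x) (norm_nonneg _) zero_le_one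
      have h2 := mul_le_mul (hζ0 x).2 (hχ.norm_gradient_le n x) (norm_nonneg _) zero_le_one
      linarith
    have hψ1 : ContDiff ℝ 1 fun x => η x ^ k := hη1.pow k
    have hψ0 : ∀ x, η x = 0 → η x ^ k = 0 := fun x hx => by
      rw [hx, zero_pow (by omega)]
    have hψc : HasCompactSupport fun x => η x ^ k :=
      HasCompactSupport.intro hηc fun x hx => hψ0 x (image_eq_zero_of_notMem_tsupport hx)
    have hψK : tsupport (fun x => η x ^ k) ⊆ Kᶜ := by
      have h1 : tsupport (fun x => η x ^ k) ⊆ (Metric.ball (0 : E) (m + 1))ᶜ := by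
        refine closure_minimal (fun x hx hxb => hx (hψ0 x ?_)) Metric.isOpen_ball.isClosed_compl
        simp [hη, hζ, hχ.eq_one m x hxb]
      exact h1.trans (compl_subset_compl.2 hm)
    have hE := hen _ hψ1 hψc hψK
    have hgη1 := continuous_gradient hη1
    have iF : Integrable fun x => F x * (η x ^ k) ^ 2 :=
      integrable_of_eq_zero_of_notMem_tsupport (hFc.mul ((hη1.continuous.pow k).pow 2)) hηc
        fun x h1 _ => by simp [hψ0 x h1]
    have iG : Integrable fun x => ‖gradient η x‖ ^ s :=
      integrable_of_eq_zero_of_notMem_tsupport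
        (hgη1.norm.rpow_const fun _ => Or.inr hs.le) hηc
        fun x _ h2 => by simp [h2, Real.zero_rpow hs.ne']
    have hZ : ∫ x, h x ^ (p - 2) * (u x * ‖gradient (fun x => η x ^ k) x‖) ^ 2 ≤
        1 / (2 * (C + 1)) * (∫ x, F x * (η x ^ k) ^ 2) + C' * ∫ x, ‖gradient η x‖ ^ s := by
      rw [← integral_const_mul, ← integral_const_mul,
        ← integral_add (iF.const_mul _) (iG.const_mul _)]
      refine integral_mono_of_nonneg (Filter.Eventually.of_forall fun x => ?_)
        ((iF.const_mul _).add (iG.const_mul _)) (Filter.Eventually.of_forall fun x => ?_)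
      · exact mul_nonneg (Real.rpow_nonneg (hh0 x) _) (sq_nonneg _)
      · have := hY (h x) |u x| (η x) ‖gradient η x‖ (hh0 x) (abs_nonneg _) (hη0 x) (hη2 x)
          (norm_nonneg _)
        simp only
        rw [gradient_fun_pow (hη1.differentiable one_ne_zero x), norm_smul,
          Real.norm_of_nonneg (by have := hη0 x; positivity)]
        rw [mul_pow, sq_abs, ← mul_pow] at this
        exact this
    have hG : ∫ x, ‖gradient η x‖ ^ s ≤ (2 * M) ^ s * ∫ x : E, (1 + ‖x‖) ^ (-s) := by
      rw [← integral_const_mul]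
      refine integral_mono iG (hint.const_mul _) fun x => ?_
      have h1 : (0 : ℝ) ≤ 1 + ‖x‖ := by positivity
      have hM := hχ.bound_nonneg
      simp only
      rw [Real.rpow_neg h1, ← Real.inv_rpow h1, ← Real.mul_rpow (by positivity) (by positivity)]
      exact Real.rpow_le_rpow (norm_nonneg _) (hgη x) hs.le
    have hX0 : 0 ≤ ∫ x, F x * (η x ^ k) ^ 2 :=
      integral_nonneg fun x => mul_nonneg (hF0 x) (sq_nonneg _)
    have h1 := hE.trans (mul_le_mul_of_nonneg_left (hZ.trans
      (add_le_add_right (mul_le_mul_of_nonneg_left hG hC') _)) hC)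
    have h2 : C * (1 / (2 * (C + 1))) ≤ 1 / 2 := by
      rw [mul_one_div, div_le_iff₀ (by positivity)]
      linarith
    have h3 := mul_le_mul_of_nonneg_right h2 hX0
    linarith
  have hf : Integrable fun x => F x * (ζ x ^ k) ^ 2 := by
    have hcov : AECover volume Filter.atTop fun n : ℕ => Metric.ball (0 : E) ((n : ℝ) + 1) :=
      aecover_ball (Filter.tendsto_atTop_add_const_right _ _ tendsto_natCast_atTop_atTop)
    have hfc : Continuous fun x => F x * (ζ x ^ k) ^ 2 :=
      hFc.mul ((hζ1.continuous.pow k).pow 2)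
    refine hcov.integrable_of_integral_bounded_of_nonneg_ae
      (2 * (C * C' * ((2 * M) ^ s * ∫ x : E, (1 + ‖x‖) ^ (-s)))) (fun n => ?_)
      (Filter.Eventually.of_forall fun x => mul_nonneg (hF0 x) (sq_nonneg _))
      (Filter.Eventually.of_forall fun n => ?_)
    · exact (hfc.continuousOn.integrableOn_compact (isCompact_closedBall 0 ((n : ℝ) + 1))).mono_set
        Metric.ball_subset_closedBall
    · refine le_trans ?_ (key n)
      have heq : ∫ x in Metric.ball (0 : E) ((n : ℝ) + 1), F x * (ζ x ^ k) ^ 2 =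
          ∫ x in Metric.ball (0 : E) ((n : ℝ) + 1), F x * ((χ n x * ζ x) ^ k) ^ 2 :=
        setIntegral_congr_fun measurableSet_ball fun x hx => by
          simp only [hχ.eq_one n x hx, one_mul]
      rw [heq]
      refine setIntegral_le_integral ?_
        (Filter.Eventually.of_forall fun x => mul_nonneg (hF0 x) (sq_nonneg _))
      refine integrable_of_eq_zero_of_notMem_tsupport
        (hFc.mul (((((hχ.contDiff n).continuous).mul hζ1.continuous).pow k).pow 2))
        (hχ.hasCompactSupport n) fun x h1 _ => ?_
      have hk0 : k ≠ 0 := by omega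
      simp [h1, hk0]
  have hrest : Integrable fun x => F x - F x * (ζ x ^ k) ^ 2 :=
    integrable_of_eq_zero_of_notMem_tsupport
      (hFc.sub (hFc.mul ((hζ1.continuous.pow k).pow 2))) (hχ.hasCompactSupport m)
      fun x h1 _ => by simp [hζ, h1]
  exact (hf.add hrest).congr (Filter.Eventually.of_forall fun x => by simp)

end Integrability

section Pohozaev

variable {E : Type*} [NormedAddCommGroup E] [InnerProductSpace ℝ E] [FiniteDimensional ℝ E]
  [MeasurableSpace E] [BorelSpace E]

lemma hasDerivAt_integral_of_isCompact {g g' : ℝ → E → ℝ} {K : Set E} (hK : IsCompact K)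
    (hg : Continuous (Function.uncurry g)) (hg' : Continuous (Function.uncurry g'))
    (hd : ∀ τ x, HasDerivAt (fun τ => g τ x) (g' τ x) τ)
    (hgK : ∀ τ ∈ Ioo (-1 : ℝ) 1, ∀ x ∉ K, g τ x = 0) :
    HasDerivAt (fun τ => ∫ x, g τ x) (∫ x, g' 0 x) 0 := by
  have hcont : ∀ τ, Continuous (g τ) := fun τ => hg.comp (Continuous.prodMk_right τ)
  have hcont' : ∀ τ, Continuous (g' τ) := fun τ => hg'.comp (Continuous.prodMk_right τ)
  have hgK' : ∀ τ ∈ Ioo (-1 : ℝ) 1, ∀ x ∉ K, g' τ x = 0 := fun τ hτ x hx => by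
    refine (hd τ x).unique ((hasDerivAt_const τ (0 : ℝ)).congr_of_eventuallyEq ?_)
    filter_upwards [isOpen_Ioo.mem_nhds hτ] with σ hσ using hgK σ hσ x hx
  obtain ⟨C, hC⟩ := (isCompact_Icc (a := (-1 : ℝ)) (b := 1)).prod hK
    |>.exists_bound_of_continuousOn hg'.continuousOn
  refine (hasDerivAt_integral_of_dominated_loc_of_deriv_le (bound := K.indicator fun _ => C)
    (Ioo_mem_nhds (by norm_num : (-1 : ℝ) < 0) one_pos)
    (Filter.Eventually.of_forall fun τ => (hcont τ).aestronglyMeasurable) ?_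
    (hcont' 0).aestronglyMeasurable (Filter.Eventually.of_forall fun x τ hτ => ?_) ?_
    (Filter.Eventually.of_forall fun x τ _ => hd τ x)).2
  · exact (hcont 0).integrable_of_hasCompactSupport
      (HasCompactSupport.intro hK fun x hx => hgK 0 (by norm_num) x hx)
  · by_cases hx : x ∈ K
    · rw [indicator_of_mem hx]
      exact hC (τ, x) ⟨Ioo_subset_Icc_self hτ, hx⟩
    · rw [indicator_of_notMem hx, hgK' τ hτ x hx, norm_zero]
  · exact (integrable_indicator_iff hK.measurableSet).2
      (integrableOn_const hK.measure_lt_top.ne)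

lemma hasDerivAt_abs_rpow_add_one_div {q : ℝ} (hq : 1 < q) (s : ℝ) :
    HasDerivAt (fun s : ℝ => |s| ^ (q + 1) / (q + 1)) (|s| ^ (q - 1) * s) s := by
  have h := (hasDerivAt_abs_rpow s (p := q + 1) (by linarith)).div_const (q + 1)
  have hq0 : q + 1 ≠ 0 := by linarith
  refine h.congr_deriv ?_
  rw [show q + 1 - 2 = q - 1 by ring]
  field_simp

/-- The Pohozaev identity localized by a cut-off `χ`. Convexity of `L` makes the energy minimal
along the dilations `x ↦ u (exp τ • x)` up to first order, hence no regularity of `u` beyond `C¹` is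
needed. -/
lemma integral_pohozaev_eq_zero {u χ L : E → ℝ} {V : E → E} {D : ℝ → E → ℝ} {q : ℝ} (hq : 1 < q)
    (hu : ContDiff ℝ 1 u) (hV : Continuous V) (hL : Continuous L)
    (hD : Continuous (Function.uncurry D))
    (hLD : ∀ τ ξ, HasDerivAt (fun τ : ℝ => L (Real.exp τ • ξ)) (D τ ξ) τ)
    (hLV : ∀ x ξ, ⟪V x, ξ - gradient u x⟫ ≤ L ξ - L (gradient u x))
    (hweak : ∀ φ : E → ℝ, ContDiff ℝ 1 φ → HasCompactSupport φ →
      ∫ x, ⟪V x, gradient φ x⟫ = ∫ x, |u x| ^ (q - 1) * u x * φ x)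
    (hχ : ContDiff ℝ 1 χ) (hχc : HasCompactSupport χ) (hχ0 : ∀ x, 0 ≤ χ x) :
    ∫ x, (χ x * D 0 (gradient u x) + ⟪V x, gradient χ x⟫ * ⟪gradient u x, x⟫ -
      (Module.finrank ℝ E * χ x + ⟪gradient χ x, x⟫) *
        (L (gradient u x) - |u x| ^ (q + 1) / (q + 1))) = 0 := by
  set N : ℝ := (Module.finrank ℝ E : ℝ) with hN
  set G : ℝ → ℝ := fun s => |s| ^ (q + 1) / (q + 1) with hG
  set f : ℝ → ℝ := fun s => |s| ^ (q - 1) * s with hf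
  have hGf : ∀ s, HasDerivAt G (f s) s := hasDerivAt_abs_rpow_add_one_div hq
  have cG : Continuous G := continuous_iff_continuousAt.2 fun s => (hGf s).continuousAt
  have cf : Continuous f :=
    (continuous_abs.rpow_const fun _ => Or.inr (by linarith)).mul continuous_id
  have hgu := continuous_gradient hu
  have hgχ := continuous_gradient hχ
  have cu := hu.continuous
  have cχ := hχ.continuous
  have hdil : ∀ (w : E → ℝ), ContDiff ℝ 1 w → ∀ (c : ℝ → ℝ) (c' τ : ℝ), HasDerivAt c c' τ →
      ∀ x, HasDerivAt (fun τ => w (c τ • x)) (c' * ⟪gradient w (c τ • x), x⟫) τ := by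
    intro w hw c c' τ hc x
    have h := (hw.differentiable one_ne_zero (c τ • x)).hasFDerivAt.comp_hasDerivAt τ
      (hc.smul_const x)
    rwa [map_smul, ← inner_gradient_left] at h
  have hexpneg : ∀ a τ : ℝ, HasDerivAt (fun τ => Real.exp (a * τ)) (Real.exp (a * τ) * a) τ :=
    fun a τ => by simpa using ((hasDerivAt_id τ).const_mul a).exp
  let g₁ : ℝ → E → ℝ := fun τ y =>
    Real.exp (-N * τ) * (χ (Real.exp (-1 * τ) • y) * (L (Real.exp τ • gradient u y) - G (u y)))
  let g₁' : ℝ → E → ℝ := fun τ y =>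
    Real.exp (-N * τ) * (-N) *
        (χ (Real.exp (-1 * τ) • y) * (L (Real.exp τ • gradient u y) - G (u y))) +
      Real.exp (-N * τ) * (Real.exp (-1 * τ) * (-1) * ⟪gradient χ (Real.exp (-1 * τ) • y), y⟫ *
          (L (Real.exp τ • gradient u y) - G (u y)) +
        χ (Real.exp (-1 * τ) • y) * D τ (gradient u y))
  let g₂ : ℝ → E → ℝ := fun τ x => ⟪V x, gradient χ x⟫ * u (Real.exp τ • x) +
    χ x * (G (u (Real.exp τ • x)) - f (u x) * u (Real.exp τ • x))
  let g₂' : ℝ → E → ℝ := fun τ x =>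
    ⟪V x, gradient χ x⟫ * (Real.exp τ * ⟪gradient u (Real.exp τ • x), x⟫) +
    χ x * (f (u (Real.exp τ • x)) * (Real.exp τ * ⟪gradient u (Real.exp τ • x), x⟫) -
      f (u x) * (Real.exp τ * ⟪gradient u (Real.exp τ • x), x⟫))
  obtain ⟨R, hR⟩ := hχc.isCompact.isBounded.subset_closedBall (0 : E)
  have h1 : HasDerivAt (fun τ => ∫ x, g₁ τ x) (∫ x, g₁' 0 x) 0 := by
    refine hasDerivAt_integral_of_isCompact (isCompact_closedBall (0 : E) (Real.exp 1 * R))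
      ?_ ?_ (fun τ x => ?_) fun τ hτ x hx => ?_
    · simp only [g₁, Function.uncurry_def]
      fun_prop
    · have hD' : Continuous fun z : ℝ × E => D z.1 (gradient u z.2) :=
        hD.comp (continuous_fst.prodMk (hgu.comp continuous_snd))
      simp only [g₁', Function.uncurry_def]
      fun_prop
    · exact (hexpneg (-N) τ).mul ((hdil χ hχ _ _ τ (hexpneg (-1) τ) x).mul
        ((hLD τ (gradient u x)).sub_const (G (u x))))
    · have : χ (Real.exp (-1 * τ) • x) = 0 := by
        by_contra hne
        have hmem := hR (subset_tsupport _ hne)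
        rw [mem_closedBall_zero_iff, norm_smul, Real.norm_of_nonneg (Real.exp_pos _).le] at hmem
        refine hx ?_
        rw [mem_closedBall_zero_iff]
        have e1 : Real.exp τ * (Real.exp (-1 * τ) * ‖x‖) = ‖x‖ := by
          rw [← mul_assoc, ← Real.exp_add]
          simp
        have hR0 : 0 ≤ R := le_trans (by positivity) hmem
        calc ‖x‖ = Real.exp τ * (Real.exp (-1 * τ) * ‖x‖) := e1.symm
          _ ≤ Real.exp τ * R := mul_le_mul_of_nonneg_left hmem (Real.exp_pos _).le
          _ ≤ Real.exp 1 * R :=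
            mul_le_mul_of_nonneg_right (Real.exp_le_exp.2 hτ.2.le) hR0
      simp only [g₁, this, zero_mul, mul_zero]
  have h2 : HasDerivAt (fun τ => ∫ x, g₂ τ x) (∫ x, g₂' 0 x) 0 := by
    refine hasDerivAt_integral_of_isCompact hχc.isCompact ?_ ?_ (fun τ x => ?_)
      fun τ _ x hx => ?_
    · simp only [g₂, Function.uncurry_def]
      fun_prop
    · simp only [g₂', Function.uncurry_def]
      fun_prop
    · have hux := hdil u hu _ _ τ (Real.hasDerivAt_exp τ) x
      exact (hux.const_mul _).add
        ((((hGf _).comp τ hux).sub (hux.const_mul (f (u x)))).const_mul (χ x))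
    · simp only [g₂, image_eq_zero_of_notMem_tsupport hx, gradient_eq_zero_of_notMem_tsupport hx,
        inner_zero_right, zero_mul, add_zero]
  let k : ℝ → E → ℝ := fun τ x => χ x * L (Real.exp τ • gradient u (Real.exp τ • x)) +
    (⟪V x, gradient χ x⟫ - χ x * f (u x)) * u (Real.exp τ • x)
  have ck : ∀ τ, Integrable (k τ) := fun τ =>
    integrable_of_eq_zero_of_notMem_tsupport (by simp only [k]; fun_prop) hχc
      fun x hx hx' => by simp only [k, hx, hx', inner_zero_right, zero_mul, add_zero, sub_zero]
  have hQ : ∀ τ, (∫ x, g₁ τ x) + ∫ x, g₂ τ x = ∫ x, k τ x := by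
    intro τ
    have e1 : ∫ x, g₁ τ x = ∫ x, χ x * (L (Real.exp τ • gradient u (Real.exp τ • x)) -
        G (u (Real.exp τ • x))) := by
      have h := Measure.integral_comp_smul volume (fun y : E => χ (Real.exp (-1 * τ) • y) *
        (L (Real.exp τ • gradient u y) - G (u y))) (Real.exp τ)
      have e2 : ∀ x : E, Real.exp (-1 * τ) • Real.exp τ • x = x := fun x => by
        rw [smul_smul, ← Real.exp_add]
        simp
      have e3 : |(Real.exp τ ^ Module.finrank ℝ E)⁻¹| = Real.exp (-N * τ) := by
        rw [abs_of_pos (by positivity), ← Real.exp_nat_mul, ← Real.exp_neg, hN, neg_mul]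
      simp only [e2, e3, smul_eq_mul] at h
      rw [h, ← integral_const_mul]
    rw [e1, ← integral_add]
    · refine integral_congr_ae (Filter.Eventually.of_forall fun x => ?_)
      simp only [g₂, k]
      ring
    · exact integrable_of_eq_zero_of_notMem_tsupport (by fun_prop) hχc
        fun x hx _ => by simp [hx]
    · exact integrable_of_eq_zero_of_notMem_tsupport (by simp only [g₂]; fun_prop) hχc
        fun x hx hx' => by simp only [g₂, hx, hx', inner_zero_right, zero_mul, add_zero]
  have hmin : IsLocalMin (fun τ => (∫ x, g₁ τ x) + ∫ x, g₂ τ x) 0 := by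
    refine Filter.Eventually.of_forall fun τ => ?_
    simp only [hQ]
    let w : E → ℝ := fun x => u (Real.exp τ • x) - u x
    have hw : ContDiff ℝ 1 w := (hu.comp (contDiff_const_smul _)).sub hu
    have hgw : ∀ x, gradient w x =
        Real.exp τ • gradient u (Real.exp τ • x) - gradient u x := fun x => by
      rw [← gradient_comp_smul u (Real.exp τ) x]
      exact gradient_fun_sub ((hu.comp (contDiff_const_smul _)).differentiable one_ne_zero x)
        (hu.differentiable one_ne_zero x)
    have hW := hweak (fun x => χ x * w x) (hχ.mul hw) hχc.mul_right
    have hgφ := continuous_gradient (hχ.mul hw)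
    have cw := hw.continuous
    have hgφx : ∀ x, gradient (fun x => χ x * w x) x = χ x • gradient w x + w x • gradient χ x :=
      fun x => gradient_fun_mul (hχ.differentiable one_ne_zero x) (hw.differentiable one_ne_zero x)
    have i1 : Integrable fun x => ⟪V x, gradient (fun x => χ x * w x) x⟫ :=
      integrable_of_eq_zero_of_notMem_tsupport (by fun_prop) hχc
        fun x hx hx' => by simp [hgφx, hx, hx']
    have i2 : Integrable fun x => f (u x) * (χ x * w x) :=
      integrable_of_eq_zero_of_notMem_tsupport (by fun_prop) hχc
        fun x hx _ => by simp [hx]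
    have h0 : ∫ x, (k τ x - k 0 x - (⟪V x, gradient (fun x => χ x * w x) x⟫ -
        f (u x) * (χ x * w x))) = (∫ x, k τ x) - ∫ x, k 0 x := by
      refine (integral_sub ((ck τ).sub (ck 0)) (i1.sub i2)).trans ?_
      rw [integral_sub' (ck τ) (ck 0), integral_sub' i1 i2, hW]
      simp only [f, sub_self, sub_zero]
    rw [← sub_nonneg, ← h0]
    refine integral_nonneg fun x => ?_
    have h3 := mul_nonneg (hχ0 x) (sub_nonneg.2
      (hLV x (Real.exp τ • gradient u (Real.exp τ • x))))
    rw [← hgw] at h3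
    simp only [Pi.zero_apply, hgφx, inner_add_right, inner_smul_right, k, w, Real.exp_zero,
      one_smul] at h3 ⊢
    linarith
  have h3 := hmin.hasDerivAt_eq_zero (h1.add h2)
  have i1 : Integrable (g₁' 0) :=
    integrable_of_eq_zero_of_notMem_tsupport (by
      have hD' : Continuous fun y : E => D 0 (gradient u y) :=
        hD.comp (continuous_const.prodMk hgu)
      simp only [g₁']
      fun_prop) hχc fun x hx hx' => by
        simp only [g₁', mul_zero, Real.exp_zero, one_smul, hx, hx', inner_zero_left, zero_mul,
          add_zero]
  have i2 : Integrable (g₂' 0) :=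
    integrable_of_eq_zero_of_notMem_tsupport (by simp only [g₂']; fun_prop) hχc
      fun x hx hx' => by simp only [g₂', hx, hx', inner_zero_right, zero_mul, add_zero]
  rw [← integral_add i1 i2] at h3
  refine Eq.trans ?_ h3
  refine integral_congr_ae (Filter.Eventually.of_forall fun x => ?_)
  simp only [g₁', g₂', hG, mul_zero, Real.exp_zero, one_smul]
  ring

end Pohozaev

section Liouville

variable {E : Type*} [NormedAddCommGroup E] [InnerProductSpace ℝ E] [FiniteDimensional ℝ E]
  [MeasurableSpace E] [BorelSpace E]

lemma tendsto_integral_of_eventually_eq {F : ℕ → E → ℝ} {f bound : E → ℝ}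
    (hF : ∀ n, Continuous (F n)) (hb : Integrable bound) (hle : ∀ n x, |F n x| ≤ bound x)
    (hev : ∀ x, ∀ᶠ n in Filter.atTop, F n x = f x) :
    Filter.Tendsto (fun n => ∫ x, F n x) Filter.atTop (nhds (∫ x, f x)) :=
  tendsto_integral_of_dominated_convergence bound (fun n => (hF n).aestronglyMeasurable) hb
    (fun n => Filter.Eventually.of_forall (hle n))
    (Filter.Eventually.of_forall fun x => tendsto_const_nhds.congr' <| by
      filter_upwards [hev x] with n hn using hn.symm)

lemma integral_inner_gradient_self_eq {u h : E → ℝ} {V : E → E} {p q s c c' : ℝ} (hp : 2 ≤ p)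
    (hq : 1 < q) (hs : 0 < s) (hprs : 1 / s = 1 / p - 1 / (q + 1))
    (hEs : (Module.finrank ℝ E : ℝ) < s) (hu : ContDiff ℝ 1 u) (hh0 : ∀ x, 0 ≤ h x)
    (hV : Continuous V) (hc : 0 ≤ c) (hVle : ∀ x, ‖V x‖ ≤ c * h x ^ (p - 1))
    (hc' : 0 ≤ c') (hgle : ∀ x, ‖gradient u x‖ ≤ c' * h x)
    (hI : Integrable fun x => h x ^ p + |u x| ^ (q + 1))
    (hweak : ∀ φ : E → ℝ, ContDiff ℝ 1 φ → HasCompactSupport φ →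
      ∫ x, ⟪V x, gradient φ x⟫ = ∫ x, |u x| ^ (q - 1) * u x * φ x) :
    ∫ x, ⟪V x, gradient u x⟫ = ∫ x, |u x| ^ (q + 1) := by
  obtain ⟨χ, M, hχ⟩ := exists_isCutoffSeq E
  have hM := hχ.bound_nonneg
  have cu := hu.continuous
  have cgu := continuous_gradient hu
  have cχ := fun n => (hχ.contDiff n).continuous
  have cgχ := fun n => continuous_gradient (hχ.contDiff n)
  have cur : Continuous fun x => |u x| ^ (q + 1) :=
    cu.abs.rpow_const fun _ => Or.inr (by linarith)
  have hpos : ∀ x, 0 ≤ h x ^ p := fun x => Real.rpow_nonneg (hh0 x) _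
  have hupos : ∀ x, 0 ≤ |u x| ^ (q + 1) := fun x => Real.rpow_nonneg (abs_nonneg _) _
  have hVG := fun x => norm_mul_norm_le_mul_rpow hp (hh0 x) hc (hVle x) (hgle x)
  have hVu : ∀ x, |⟪V x, gradient u x⟫| ≤ c * c' * h x ^ p := fun x =>
    (abs_real_inner_le_norm _ _).trans (hVG x)
  have habs : ∀ n x, |χ n x| ≤ 1 := fun n x => by
    rw [abs_of_nonneg (hχ.nonneg n x)]
    exact hχ.le_one n x
  have t1 := tendsto_integral_of_eventually_eq (F := fun n x => ⟪V x, gradient u x⟫ * χ n x)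
    (f := fun x => ⟪V x, gradient u x⟫) (fun n => by fun_prop) (hI.const_mul (c * c'))
    (fun n x => by
      rw [abs_mul]
      calc _ ≤ |⟪V x, gradient u x⟫| * 1 := by gcongr; exact habs n x
        _ ≤ c * c' * h x ^ p := by rw [mul_one]; exact hVu x
        _ ≤ _ := by gcongr; exact le_add_of_nonneg_right (hupos x))
    (fun x => by
      filter_upwards [hχ.eventually_eq x] with n hn
      rw [hn.1, mul_one])
  have t2 := tendsto_integral_of_eventually_eq (F := fun n x => |u x| ^ (q + 1) * χ n x)
    (f := fun x => |u x| ^ (q + 1)) (fun n => by fun_prop) hI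
    (fun n x => by
      rw [abs_mul, abs_of_nonneg (hupos x)]
      calc _ ≤ |u x| ^ (q + 1) * 1 := mul_le_mul_of_nonneg_left (habs n x) (hupos x)
        _ ≤ _ := by rw [mul_one]; exact le_add_of_nonneg_left (hpos x))
    (fun x => by
      filter_upwards [hχ.eventually_eq x] with n hn
      rw [hn.1, mul_one])
  have hJ : Integrable fun x : E => (M * (1 + ‖x‖)⁻¹) ^ s := by
    have h1 := (integrable_one_add_norm (μ := (volume : Measure E)) hEs).const_mul (M ^ s)
    refine h1.congr (Filter.Eventually.of_forall fun x => ?_)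
    have hx : (0 : ℝ) ≤ 1 + ‖x‖ := by positivity
    simp only
    rw [Real.mul_rpow hM (inv_nonneg.2 hx), Real.rpow_neg hx, Real.inv_rpow hx]
  have t3 := tendsto_integral_of_eventually_eq (F := fun n x => u x * ⟪V x, gradient (χ n) x⟫)
    (f := fun _ => 0) (fun n => by fun_prop) ((hI.add hJ).const_mul c)
    (fun n x => by
      have h1 := rpow_sub_one_mul_mul_le hp (by linarith : 0 < q + 1) hs hprs (hh0 x)
        (abs_nonneg (u x)) (norm_nonneg (gradient (χ n) x))
      have h2 : ‖gradient (χ n) x‖ ^ s ≤ (M * (1 + ‖x‖)⁻¹) ^ s :=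
        Real.rpow_le_rpow (norm_nonneg _) (hχ.norm_gradient_le n x) hs.le
      rw [abs_mul]
      calc _ ≤ |u x| * (‖V x‖ * ‖gradient (χ n) x‖) := by
            gcongr; exact abs_real_inner_le_norm _ _
        _ ≤ |u x| * (c * h x ^ (p - 1) * ‖gradient (χ n) x‖) := by gcongr; exact hVle x
        _ = c * (h x ^ (p - 1) * (|u x| * ‖gradient (χ n) x‖)) := by ring
        _ ≤ c * (h x ^ p + |u x| ^ (q + 1) + (M * (1 + ‖x‖)⁻¹) ^ s) := by
            gcongr; linarith)
    (fun x => by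
      filter_upwards [hχ.eventually_eq x] with n hn
      rw [hn.2, inner_zero_right, mul_zero])
  have key := fun n => integral_inner_gradient_mul_add hq hu hV hweak (hχ.contDiff n)
    (hχ.hasCompactSupport n)
  have hlim := t1.add t3
  simp only [key, integral_zero, add_zero] at hlim
  exact tendsto_nhds_unique hlim t2

/-- A solution of finite energy vanishes identically below the Pohozaev exponent. -/
lemma eq_zero_of_integrable_energy {u h L : E → ℝ} {V : E → E} {D : ℝ → E → ℝ}
    {p q s c c' κ : ℝ} (hp : 2 ≤ p)
    (hq : 1 < q) (hs : 0 < s) (hprs : 1 / s = 1 / p - 1 / (q + 1))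
    (hEs : (Module.finrank ℝ E : ℝ) < s) (hu : ContDiff ℝ 1 u) (hh0 : ∀ x, 0 ≤ h x)
    (hV : Continuous V) (hc : 0 ≤ c) (hVle : ∀ x, ‖V x‖ ≤ c * h x ^ (p - 1))
    (hc' : 0 ≤ c') (hgle : ∀ x, ‖gradient u x‖ ≤ c' * h x)
    (hI : Integrable fun x => h x ^ p + |u x| ^ (q + 1))
    (hweak : ∀ φ : E → ℝ, ContDiff ℝ 1 φ → HasCompactSupport φ →
      ∫ x, ⟪V x, gradient φ x⟫ = ∫ x, |u x| ^ (q - 1) * u x * φ x)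
    (hL : Continuous L) (hD : Continuous (Function.uncurry D))
    (hLD : ∀ τ ξ, HasDerivAt (fun τ : ℝ => L (Real.exp τ • ξ)) (D τ ξ) τ)
    (hLV : ∀ x ξ, ⟪V x, ξ - gradient u x⟫ ≤ L ξ - L (gradient u x))
    (hDV : ∀ x, D 0 (gradient u x) = ⟪V x, gradient u x⟫)
    (hL0 : ∀ x, 0 ≤ L (gradient u x))
    (hLκ : ∀ x, L (gradient u x) ≤ κ * ⟪V x, gradient u x⟫) (hκ0 : 0 ≤ κ)
    (hκ : Module.finrank ℝ E * κ < 1 + Module.finrank ℝ E / (q + 1)) (x : E) : u x = 0 := by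
  have hen := integral_inner_gradient_self_eq hp hq hs hprs hEs hu hh0 hV hc hVle hc' hgle hI hweak
  obtain ⟨χ, M, hχ⟩ := exists_isCutoffSeq E
  have hM := hχ.bound_nonneg
  have cu := hu.continuous
  have cgu := continuous_gradient hu
  have cχ := fun n => (hχ.contDiff n).continuous
  have cgχ := fun n => continuous_gradient (hχ.contDiff n)
  have cur : Continuous fun x => |u x| ^ (q + 1) :=
    cu.abs.rpow_const fun _ => Or.inr (by linarith)
  have cD : Continuous fun x => D 0 (gradient u x) := hD.comp (continuous_const.prodMk cgu)
  set N : ℝ := (Module.finrank ℝ E : ℝ) with hN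
  have hN0 : 0 ≤ N := Nat.cast_nonneg _
  have hpos : ∀ x, 0 ≤ h x ^ p := fun x => Real.rpow_nonneg (hh0 x) _
  have hupos : ∀ x, 0 ≤ |u x| ^ (q + 1) := fun x => Real.rpow_nonneg (abs_nonneg _) _
  have hVG := fun x => norm_mul_norm_le_mul_rpow hp (hh0 x) hc (hVle x) (hgle x)
  have hVu : ∀ x, |⟪V x, gradient u x⟫| ≤ c * c' * h x ^ p := fun x =>
    (abs_real_inner_le_norm _ _).trans (hVG x)
  have hLle : ∀ x, L (gradient u x) ≤ κ * (c * c' * h x ^ p) := fun x =>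
    (hLκ x).trans (mul_le_mul_of_nonneg_left ((le_abs_self _).trans (hVu x)) hκ0)
  have iu : Integrable fun x => |u x| ^ (q + 1) :=
    hI.mono' cur.aestronglyMeasurable (Filter.Eventually.of_forall fun x => by
      rw [Real.norm_of_nonneg (hupos x)]
      exact le_add_of_nonneg_left (hpos x))
  have iV : Integrable fun x => ⟪V x, gradient u x⟫ :=
    (hI.const_mul (c * c')).mono' (hV.inner cgu).aestronglyMeasurable
      (Filter.Eventually.of_forall fun x => (hVu x).trans
        (mul_le_mul_of_nonneg_left (le_add_of_nonneg_right (hupos x)) (by positivity)))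
  have iL : Integrable fun x => L (gradient u x) :=
    (iV.const_mul κ).mono' (hL.comp cgu).aestronglyMeasurable
      (Filter.Eventually.of_forall fun x => by
        rw [Real.norm_of_nonneg (hL0 x)]
        exact hLκ x)
  have t := tendsto_integral_of_eventually_eq
    (F := fun n x => χ n x * D 0 (gradient u x) + ⟪V x, gradient (χ n) x⟫ * ⟪gradient u x, x⟫ -
      (N * χ n x + ⟪gradient (χ n) x, x⟫) * (L (gradient u x) - |u x| ^ (q + 1) / (q + 1)))
    (f := fun x => ⟪V x, gradient u x⟫ - N * (L (gradient u x) - |u x| ^ (q + 1) / (q + 1)))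
    (fun n => by fun_prop)
    (hI.const_mul (c * c' + c * c' * M + (N + M) * (κ * (c * c') + 1)))
    (fun n x => by
      have hxM : ‖gradient (χ n) x‖ * ‖x‖ ≤ M :=
        (mul_le_mul_of_nonneg_left (by linarith) (norm_nonneg _)).trans
          (hχ.norm_gradient_mul_le n x)
      have b1 : |χ n x * D 0 (gradient u x)| ≤ c * c' * h x ^ p := by
        rw [abs_mul, abs_of_nonneg (hχ.nonneg n x), hDV]
        exact (mul_le_of_le_one_left (abs_nonneg _) (hχ.le_one n x)).trans (hVu x)
      have b2 : |⟪V x, gradient (χ n) x⟫ * ⟪gradient u x, x⟫| ≤ c * c' * M * h x ^ p := by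
        rw [abs_mul]
        calc _ ≤ (‖V x‖ * ‖gradient (χ n) x‖) * (‖gradient u x‖ * ‖x‖) :=
              mul_le_mul (abs_real_inner_le_norm _ _) (abs_real_inner_le_norm _ _)
                (abs_nonneg _) (by positivity)
          _ = (‖V x‖ * ‖gradient u x‖) * (‖gradient (χ n) x‖ * ‖x‖) := by ring
          _ ≤ (c * c' * h x ^ p) * M :=
            mul_le_mul (hVG x) hxM (by positivity) ((by positivity : (0 : ℝ) ≤ _).trans (hVG x))
          _ = c * c' * M * h x ^ p := by ring
      have b3 : |N * χ n x + ⟪gradient (χ n) x, x⟫| ≤ N + M := by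
        refine (abs_add_le _ _).trans (add_le_add ?_ ((abs_real_inner_le_norm _ _).trans hxM))
        rw [abs_of_nonneg (mul_nonneg hN0 (hχ.nonneg n x))]
        exact mul_le_of_le_one_right hN0 (hχ.le_one n x)
      have b4 : |L (gradient u x) - |u x| ^ (q + 1) / (q + 1)| ≤
          κ * (c * c') * h x ^ p + |u x| ^ (q + 1) := by
        have h1 := hL0 x
        have h2 := hLle x
        have h3 : |u x| ^ (q + 1) / (q + 1) ≤ |u x| ^ (q + 1) :=
          div_le_self (hupos x) (by linarith)
        have h4 : 0 ≤ |u x| ^ (q + 1) / (q + 1) := div_nonneg (hupos x) (by linarith)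
        have h5 := mul_nonneg hκ0 (mul_nonneg (mul_nonneg hc hc') (hpos x))
        rw [abs_le]
        constructor <;> linarith
      have b5 : κ * (c * c') * h x ^ p + |u x| ^ (q + 1) ≤
          (κ * (c * c') + 1) * (h x ^ p + |u x| ^ (q + 1)) := by
        have h5 := mul_nonneg (mul_nonneg hκ0 (mul_nonneg hc hc')) (hupos x)
        linarith [hpos x]
      have b6 := mul_le_mul b3 (b4.trans b5) (abs_nonneg _) (by positivity)
      rw [← abs_mul] at b6
      have b7 := mul_nonneg (mul_nonneg hc hc') (hupos x)
      have b8 := mul_nonneg (mul_nonneg (mul_nonneg hc hc') hM) (hupos x)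
      refine (abs_sub _ _).trans ?_
      have b9 := abs_add_le (χ n x * D 0 (gradient u x))
        (⟪V x, gradient (χ n) x⟫ * ⟪gradient u x, x⟫)
      linarith)
    (fun x => by
      filter_upwards [hχ.eventually_eq x] with n hn
      rw [hn.1, hn.2, hDV, inner_zero_right, inner_zero_left]
      ring)
  have key := fun n => integral_pohozaev_eq_zero hq hu hV hL hD hLD hLV hweak (hχ.contDiff n)
    (hχ.hasCompactSupport n) (hχ.nonneg n)
  simp only [← hN] at key
  simp only [key] at t
  have h0 := tendsto_nhds_unique tendsto_const_nhds t
  have i2 : Integrable fun x => L (gradient u x) - |u x| ^ (q + 1) / (q + 1) :=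
    iL.sub (iu.div_const _)
  rw [integral_sub iV (i2.const_mul N), integral_const_mul, integral_sub iL (iu.div_const _),
    integral_div, hen] at h0
  have hle : ∫ x, L (gradient u x) ≤ κ * ∫ x, |u x| ^ (q + 1) := by
    rw [← hen, ← integral_const_mul]
    exact integral_mono iL (iV.const_mul κ) hLκ
  have hnn : 0 ≤ ∫ x, |u x| ^ (q + 1) := integral_nonneg hupos
  have hz : ∫ x, |u x| ^ (q + 1) = 0 := by
    refine le_antisymm (not_lt.1 fun hpos' => ?_) hnn
    have h1 := mul_le_mul_of_nonneg_left hle hN0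
    have h2 := mul_lt_mul_of_pos_right hκ hpos'
    have h3 : N * ((∫ x, |u x| ^ (q + 1)) / (q + 1)) = N / (q + 1) * ∫ x, |u x| ^ (q + 1) := by ring
    linarith
  have hae := (cur.ae_eq_iff_eq volume continuous_zero).1
    ((integral_eq_zero_iff_of_nonneg hupos iu).1 hz)
  by_contra hx
  exact (Real.rpow_pos_of_pos (abs_pos.2 hx) (q + 1)).ne' (congrFun hae x)

end Liouville

section FinslerEquation

variable {N : ℕ} {H : EuclideanSpace ℝ (Fin N) → ℝ} {B : ℝ → ℝ}
  {u : EuclideanSpace ℝ (Fin N) → ℝ} {p q γ Γ : ℝ}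

lemma add_sq_le_one_add_mul {ε : ℝ} (hε : 0 < ε) (a b : ℝ) :
    (a + b) ^ 2 ≤ (1 + ε) * a ^ 2 + (1 + 1 / ε) * b ^ 2 := by
  have h : (1 + ε) * a ^ 2 + (1 + 1 / ε) * b ^ 2 - (a + b) ^ 2 = (ε * a - b) ^ 2 / ε := by
    field_simp
    ring
  have : 0 ≤ (ε * a - b) ^ 2 / ε := by positivity
  linarith

lemma IsStableOn.integral_le {S : Set (EuclideanSpace ℝ (Fin N))} (hH : IsFinslerNorm H)
    (hB : SatisfiesHB B p 0 γ Γ) (hp : 2 ≤ p) (hq : 1 < q) (hu : ContDiff ℝ 1 u)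
    (hstab : IsStableOn Set.univ S B H u q) {ε : ℝ} (hε : 0 < ε) :
    ∃ C : ℝ, 0 ≤ C ∧ ∀ ψ : EuclideanSpace ℝ (Fin N) → ℝ, ContDiff ℝ 1 ψ →
      HasCompactSupport ψ → tsupport ψ ⊆ S →
      q * ∫ x, |u x| ^ (q + 1) * ψ x ^ 2 ≤
        (1 + ε) * (Γ * (p - 1)) * (∫ x, H (gradient u x) ^ p * ψ x ^ 2) +
          C * ∫ x, H (gradient u x) ^ (p - 2) * (u x * ‖gradient ψ x‖) ^ 2 := by
  have hΓ : 0 < Γ := hB.2.2.2.2.2.2.2.2.1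
  obtain ⟨C₀, hC₀, hHC⟩ := hH.le_mul_norm
  obtain ⟨M, hM, hHM⟩ := hH.hessian_bound
  have hA : 0 ≤ Γ * (p - 1) := mul_nonneg hΓ.le (by linarith)
  refine ⟨(1 + 1 / ε) * (Γ * (p - 1)) * C₀ ^ 2 + Γ * M, by positivity, fun ψ hψ hψc hψS => ?_⟩
  set h : EuclideanSpace ℝ (Fin N) → ℝ := fun x => H (gradient u x) with hh
  have hh0 : ∀ x, 0 ≤ h x := fun x => hH.nonneg _
  have hpow : ∀ x, 0 ≤ h x ^ (p - 2) := fun x => Real.rpow_nonneg (hh0 x) _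
  have cu := hu.continuous
  have cψ := hψ.continuous
  have cgψ := continuous_gradient hψ
  have ch : Continuous h := hH.continuous.comp (continuous_gradient hu)
  have chp : Continuous fun x => h x ^ p := ch.rpow_const fun _ => Or.inr (by linarith)
  have chp2 : Continuous fun x => h x ^ (p - 2) := ch.rpow_const fun _ => Or.inr (by linarith)
  have i1 : Integrable fun x => h x ^ p * ψ x ^ 2 :=
    integrable_of_eq_zero_of_notMem_tsupport (by fun_prop) hψc fun x hx _ => by simp [hx]
  have i2 : Integrable fun x => h x ^ (p - 2) * (u x * ‖gradient ψ x‖) ^ 2 :=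
    integrable_of_eq_zero_of_notMem_tsupport (by fun_prop) hψc fun x _ hx => by simp [hx]
  have hgφ : ∀ x, gradient (fun x => u x * ψ x) x = ψ x • gradient u x + u x • gradient ψ x :=
    fun x => by
      rw [gradient_fun_mul (hu.differentiable one_ne_zero x) (hψ.differentiable one_ne_zero x),
        add_comm]
  have hst := hstab (fun x => u x * ψ x) (hu.mul hψ) hψc.mul_left
    ((tsupport_mul_subset_right).trans hψS)
  simp only [setIntegral_univ] at hst
  have e3 : ∫ x, q * |u x| ^ (q - 1) * (u x * ψ x) ^ 2 = q * ∫ x, |u x| ^ (q + 1) * ψ x ^ 2 := by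
    rw [← integral_const_mul]
    refine integral_congr_ae (Filter.Eventually.of_forall fun x => ?_)
    simp only [← abs_rpow_sub_one_mul hq]
    ring
  have b1 : ∫ x, deriv (deriv B) (H (gradient u x)) *
      ⟪gradient H (gradient u x), gradient (fun x => u x * ψ x) x⟫ ^ 2 ≤
      (1 + ε) * (Γ * (p - 1)) * (∫ x, h x ^ p * ψ x ^ 2) +
        (1 + 1 / ε) * (Γ * (p - 1)) * C₀ ^ 2 *
          ∫ x, h x ^ (p - 2) * (u x * ‖gradient ψ x‖) ^ 2 := by
    rw [← integral_const_mul, ← integral_const_mul,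
      ← integral_add (i1.const_mul _) (i2.const_mul _)]
    refine integral_mono_of_nonneg (Filter.Eventually.of_forall fun x => ?_)
      ((i1.const_mul _).add (i2.const_mul _)) (Filter.Eventually.of_forall fun x => ?_)
    · by_cases hx : gradient u x = 0
      · simp [hx, hH.gradient_zero]
      · exact mul_nonneg (hB.2.2.2.1 _ (hH.pos hx)).2.2.le (sq_nonneg _)
    · have hr : 0 ≤ (1 + ε) * (Γ * (p - 1)) * (h x ^ p * ψ x ^ 2) +
          (1 + 1 / ε) * (Γ * (p - 1)) * C₀ ^ 2 *
            (h x ^ (p - 2) * (u x * ‖gradient ψ x‖) ^ 2) := by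
        have := hpow x
        have := Real.rpow_nonneg (hh0 x) p
        positivity
      by_cases hx : gradient u x = 0
      · simpa only [hx, hH.gradient_zero, inner_zero_left, ne_eq, OfNat.ofNat_ne_zero,
          not_false_eq_true, zero_pow, mul_zero] using hr
      have hB2 := (hB.2.2.2.2.2.2.2.2.2.2 _ (hH.pos hx)).2
      rw [zero_add] at hB2
      have hin : ⟪gradient H (gradient u x), gradient (fun x => u x * ψ x) x⟫ =
          ψ x * h x + u x * ⟪gradient H (gradient u x), gradient ψ x⟫ := by
        rw [hgφ, inner_add_right, inner_smul_right, inner_smul_right, hH.inner_gradient_self]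
      have hb : ⟪gradient H (gradient u x), gradient ψ x⟫ ^ 2 ≤ (C₀ * ‖gradient ψ x‖) ^ 2 :=
        sq_le_sq' (by linarith [(abs_le.1 (hH.abs_inner_gradient_le (gradient u x)
          (gradient ψ x))).1, hHC (gradient ψ x)])
          ((hH.inner_gradient_le _ _).trans (hHC _))
      calc _ ≤ Γ * (p - 1) * h x ^ (p - 2) * (ψ x * h x +
              u x * ⟪gradient H (gradient u x), gradient ψ x⟫) ^ 2 := by
            simp only [hin]
            exact mul_le_mul_of_nonneg_right hB2 (sq_nonneg _)
        _ ≤ Γ * (p - 1) * h x ^ (p - 2) * ((1 + ε) * (ψ x * h x) ^ 2 +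
              (1 + 1 / ε) * (u x * ⟪gradient H (gradient u x), gradient ψ x⟫) ^ 2) :=
            mul_le_mul_of_nonneg_left (add_sq_le_one_add_mul hε _ _) (mul_nonneg hA (hpow x))
        _ ≤ Γ * (p - 1) * h x ^ (p - 2) * ((1 + ε) * (ψ x * h x) ^ 2 +
              (1 + 1 / ε) * (u x ^ 2 * (C₀ * ‖gradient ψ x‖) ^ 2)) := by
            rw [mul_pow (u x)]
            have := hpow x
            gcongr
        _ = _ := by
            simp only
            rw [rpow_eq_mul_sq hp (hh0 x)]
            ring
  have b2 : ∫ x, deriv B (H (gradient u x)) * ⟪fderiv ℝ (gradient H) (gradient u x)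
      (gradient (fun x => u x * ψ x) x), gradient (fun x => u x * ψ x) x⟫ ≤
      Γ * M * ∫ x, h x ^ (p - 2) * (u x * ‖gradient ψ x‖) ^ 2 := by
    have hr : ∀ x, 0 ≤ Γ * M * (h x ^ (p - 2) * (u x * ‖gradient ψ x‖) ^ 2) := fun x => by
      have := hpow x
      positivity
    rw [← integral_const_mul]
    by_cases hi : Integrable fun x => deriv B (H (gradient u x)) * ⟪fderiv ℝ (gradient H)
        (gradient u x) (gradient (fun x => u x * ψ x) x), gradient (fun x => u x * ψ x) x⟫
    · refine integral_mono hi (i2.const_mul _) fun x => ?_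
      by_cases hx : gradient u x = 0
      · simpa only [hx, hH.zero, hB.2.2.1, zero_mul] using hr x
      have hhx : 0 < h x := hH.pos hx
      have hX := hHM (gradient u x) (u x • gradient ψ x)
      rw [norm_smul, mul_pow, Real.norm_eq_abs, sq_abs, ← mul_pow] at hX
      have hB1 := (hB.deriv_bounds (hh0 x)).2
      rw [rpow_sub_one_eq_mul hp (hh0 x), ← mul_assoc, ← div_le_iff₀ hhx] at hB1
      have hB0 : 0 ≤ deriv B (h x) / h x := div_nonneg (hB.deriv_nonneg (hh0 x)) (hh0 x)
      simp only [hgφ, hH.inner_hessian_smul_add hx]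
      calc _ = deriv B (h x) / h x * (h x * ⟪fderiv ℝ (gradient H) (gradient u x)
              (u x • gradient ψ x), u x • gradient ψ x⟫) := by
            field_simp
            exact mul_comm _ _
        _ ≤ deriv B (h x) / h x * (M * (u x * ‖gradient ψ x‖) ^ 2) :=
            mul_le_mul_of_nonneg_left hX hB0
        _ ≤ Γ * h x ^ (p - 2) * (M * (u x * ‖gradient ψ x‖) ^ 2) :=
            mul_le_mul_of_nonneg_right hB1 (by positivity)
        _ = _ := by ring
    · rw [integral_undef hi]
      exact integral_nonneg hr
  rw [e3] at hst
  linarith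

lemma continuous_flux (hH : IsFinslerNorm H) (hB : SatisfiesHB B p 0 γ Γ) (hu : ContDiff ℝ 1 u) :
    Continuous fun x => deriv B (H (gradient u x)) • gradient H (gradient u x) := by
  obtain ⟨C, hC, hHC⟩ := hH.le_mul_norm
  have cB : Continuous fun ξ => deriv B (H ξ) := by
    have := hB.continuous_deriv_abs.comp hH.continuous
    simpa only [Function.comp_def, abs_of_nonneg (hH.nonneg _)] using this
  suffices hc : Continuous fun ξ => deriv B (H ξ) • gradient H ξ from
    hc.comp (continuous_gradient hu)
  refine continuous_iff_continuousAt.2 fun ξ => ?_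
  by_cases hξ : ξ = 0
  · subst hξ
    rw [ContinuousAt, hH.gradient_zero, smul_zero]
    refine squeeze_zero_norm (a := fun ξ => deriv B (H ξ) * C) (fun ξ => ?_) ?_
    · rw [norm_smul, Real.norm_of_nonneg (hB.deriv_nonneg (hH.nonneg _))]
      exact mul_le_mul_of_nonneg_left (hH.norm_gradient_le hHC hC.le ξ)
        (hB.deriv_nonneg (hH.nonneg _))
    · simpa [hH.zero, hB.2.2.1] using (cB.tendsto 0).mul_const C
  · exact cB.continuousAt.smul (hH.gradient_differentiableAt_continuousAt hξ).1.continuousAt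

end FinslerEquation

lemma exponent_bounds {N p q γ Γ : ℝ} (hp : 2 ≤ p) (hN : 0 < N) (hγ : 0 < γ) (hγΓ : γ ≤ Γ)
    (hcond : (Γ * γ⁻¹ * (p - 1) < q ∧ N ≤ p * γ * Γ⁻¹) ∨
      (N > p * γ * Γ⁻¹ ∧ Γ * γ⁻¹ * (p - 1) < q ∧
        q < (N * (p - Γ / γ) + p) / (N * (Γ / γ) - p))) :
    Γ * (p - 1) < q * γ ∧ p < q + 1 ∧ N * (Γ / (γ * p)) < 1 + N / (q + 1) := by
  have hΓ : 0 < Γ := by linarith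
  have hp0 : 0 < p := by linarith
  obtain ⟨t, ht⟩ : ∃ t, t = Γ / γ := ⟨_, rfl⟩
  have ht1 : 1 ≤ t := by rw [ht]; exact (one_le_div hγ).2 hγΓ
  have e1 : Γ * γ⁻¹ = t := by rw [ht, div_eq_mul_inv]
  have e2 : p * γ * Γ⁻¹ = p / t := by rw [ht]; field_simp
  have e3 : N * (Γ / (γ * p)) = N * t / p := by rw [ht]; field_simp
  have e4 : Γ = t * γ := by rw [ht]; field_simp
  rw [e1, e2, ← ht] at hcond
  have hq : t * (p - 1) < q := hcond.elim And.left fun h => h.2.1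
  have hqp : p < q + 1 := by nlinarith
  refine ⟨by rw [e4]; nlinarith, hqp, ?_⟩
  rw [e3]
  rcases hcond with ⟨-, h⟩ | ⟨h1, -, h2⟩
  · rw [le_div_iff₀ (by linarith)] at h
    have h3 : N * t / p ≤ 1 := (div_le_one hp0).2 h
    have h4 : 0 < N / (q + 1) := div_pos hN (by linarith)
    linarith
  · rw [gt_iff_lt, div_lt_iff₀ (by linarith)] at h1
    rw [lt_div_iff₀ (by linarith)] at h2
    rw [← sub_lt_iff_lt_add', lt_div_iff₀ (by linarith), div_sub_one hp0.ne', div_mul_eq_mul_div,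
      div_lt_iff₀ hp0]
    linarith

/-- Energy finiteness \eqref{usarepoh}: for a solution stable outside a compact set under
the assumptions of Theorem 1.6 one has `B(H(∇u)) ∈ L¹(ℝ^N)` and `u ∈ L^{q+1}(ℝ^N)`. -/
theorem energy_finiteness_stable_outside_compact {N : ℕ} (hN : 2 ≤ N)
    (H : EuclideanSpace ℝ (Fin N) → ℝ) (B : ℝ → ℝ)
    (u : EuclideanSpace ℝ (Fin N) → ℝ) (K : Set (EuclideanSpace ℝ (Fin N)))
    (p γ Γ q : ℝ)
    (hH : IsFinslerNorm H) (hB : SatisfiesHB B p 0 γ Γ) (hp : 2 ≤ p) (hq : 1 < q)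
    (hu : ContDiff ℝ 1 u) (hK : IsCompact K)
    (hsol : IsWeakSolutionOn Set.univ B H u q)
    (hstab : IsStableOn Set.univ Kᶜ B H u q)
    (hcond : (Γ * γ⁻¹ * (p - 1) < q ∧ (N : ℝ) ≤ p * γ * Γ⁻¹) ∨
      ((N : ℝ) > p * γ * Γ⁻¹ ∧ Γ * γ⁻¹ * (p - 1) < q ∧
        q < ((N : ℝ) * (p - Γ / γ) + p) / ((N : ℝ) * (Γ / γ) - p))) :
    Integrable (fun x => B (H (gradient u x))) ∧
      Integrable (fun x => |u x| ^ (q + 1)) := by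
  have hγ : 0 < γ := hB.2.2.2.2.2.2.2.1
  have hΓ : 0 < Γ := hB.2.2.2.2.2.2.2.2.1
  have hp0 : 0 < p := by linarith
  obtain ⟨hAq, hqp, hκ⟩ :=
    exponent_bounds hp (Nat.cast_pos.2 (by omega : 0 < N)) hγ hB.gamma_le hcond
  have hr : 0 < q + 1 - p := by linarith
  set s : ℝ := p * (q + 1) / (q + 1 - p) with hs
  have hs0 : 0 < s := by positivity
  have hprs : 1 / s = 1 / p - 1 / (q + 1) := by
    rw [hs]
    field_simp
  have hNs : (N : ℝ) < s := by
    have h1 : (N : ℝ) * (1 / s) < 1 := by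
      have h2 : (N : ℝ) * (1 / p) ≤ N * (Γ / (γ * p)) := by
        refine mul_le_mul_of_nonneg_left ?_ (Nat.cast_nonneg N)
        rw [div_le_div_iff₀ hp0 (by positivity)]
        nlinarith [hB.gamma_le]
      rw [hprs, mul_sub]
      have h3 : (N : ℝ) * (1 / (q + 1)) = N / (q + 1) := by ring
      linarith
    rwa [mul_one_div, div_lt_one hs0] at h1
  have hfin : (Module.finrank ℝ (EuclideanSpace ℝ (Fin N)) : ℝ) = N := by
    rw [finrank_euclideanSpace_fin]
  set V : EuclideanSpace ℝ (Fin N) → EuclideanSpace ℝ (Fin N) :=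
    fun x => deriv B (H (gradient u x)) • gradient H (gradient u x) with hVdef
  have hV : Continuous V := continuous_flux hH hB hu
  obtain ⟨C, hC, hHC⟩ := hH.le_mul_norm
  obtain ⟨C', hC', hHC'⟩ := hH.norm_le_mul
  have hh0 : ∀ x, 0 ≤ H (gradient u x) := fun x => hH.nonneg _
  have hVle : ∀ x, ‖V x‖ ≤ Γ * C * H (gradient u x) ^ (p - 1) := fun x => by
    rw [norm_smul, Real.norm_of_nonneg (hB.deriv_nonneg (hh0 x))]
    calc _ ≤ Γ * H (gradient u x) ^ (p - 1) * C :=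
          mul_le_mul (hB.deriv_bounds (hh0 x)).2 (hH.norm_gradient_le hHC hC.le _)
            (norm_nonneg _) (mul_nonneg hΓ.le (Real.rpow_nonneg (hh0 x) _))
      _ = _ := by ring
  have hVi : ∀ x, ⟪V x, gradient u x⟫ = deriv B (H (gradient u x)) * H (gradient u x) :=
    fun x => by rw [real_inner_smul_left, hH.inner_gradient_self]
  have hVu : ∀ x, γ * H (gradient u x) ^ p ≤ ⟪V x, gradient u x⟫ := fun x => by
    rw [hVi, rpow_eq_mul_sq hp (hh0 x)]
    have h1 := mul_le_mul_of_nonneg_right (hB.deriv_bounds (hh0 x)).1 (hh0 x)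
    rw [rpow_sub_one_eq_mul hp (hh0 x)] at h1
    linarith
  have hweak : ∀ φ : EuclideanSpace ℝ (Fin N) → ℝ, ContDiff ℝ 1 φ → HasCompactSupport φ →
      ∫ x, ⟪V x, gradient φ x⟫ = ∫ x, |u x| ^ (q - 1) * u x * φ x := fun φ hφ hφc => by
    have h1 := hsol φ hφ hφc (subset_univ _)
    simp only [setIntegral_univ] at h1
    simpa only [hVdef, real_inner_smul_left] using h1
  have hen := exists_energy_le (S := Kᶜ) hp hq (mul_pos hΓ (by linarith : 0 < p - 1)) hAq hu
    (hH.continuous.comp (continuous_gradient hu)) hh0 hV hVle hVu hweak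
    fun ε hε => hstab.integral_le hH hB hp hq hu hε
  have hI := integrable_of_energy_le hp (by linarith : 0 < q + 1) hs0 hprs (by rwa [hfin])
    hu.continuous (hH.continuous.comp (continuous_gradient hu)) hh0 hK hen
  obtain ⟨P, hP, hPle, hPconv⟩ := hB.exists_primitive
  have hu0 : u = 0 := funext <| eq_zero_of_integrable_energy (L := fun ξ => P (H ξ))
    (D := fun τ ξ => deriv B |Real.exp τ * H ξ| * (Real.exp τ * H ξ)) (κ := Γ / (γ * p))
    hp hq hs0 hprs (by rwa [hfin]) hu hh0 hV (mul_nonneg hΓ.le hC.le) hVle hC'.le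
    (fun x => hHC' _) hI hweak
    ((continuous_iff_continuousAt.2 fun t => (hP t).continuousAt).comp hH.continuous)
    (by
      have h1 : Continuous fun z : ℝ × EuclideanSpace ℝ (Fin N) => Real.exp z.1 * H z.2 :=
        (Real.continuous_exp.comp continuous_fst).mul (hH.continuous.comp continuous_snd)
      exact (hB.continuous_deriv_abs.comp h1).mul h1)
    (fun τ ξ => by
      have h1 := (hP (Real.exp τ * H ξ)).comp τ ((Real.hasDerivAt_exp τ).mul_const (H ξ))
      simpa only [Function.comp_def, hH.2.1, abs_of_pos (Real.exp_pos _)] using h1)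
    (fun x ξ => by
      rw [real_inner_smul_left, inner_sub_right, hH.inner_gradient_self]
      exact (mul_le_mul_of_nonneg_left (sub_le_sub_right (hH.inner_gradient_le _ _) _)
        (hB.deriv_nonneg (hh0 x))).trans (hPconv _ _ (hh0 x) (hH.nonneg ξ)))
    (fun x => by rw [hVi, Real.exp_zero, one_mul, abs_of_nonneg (hh0 x)])
    (fun x => (hPle _ (hh0 x)).1)
    (fun x => by
      calc _ ≤ Γ / p * H (gradient u x) ^ p := (hPle _ (hh0 x)).2
        _ = Γ / (γ * p) * (γ * H (gradient u x) ^ p) := by field_simp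
        _ ≤ _ := mul_le_mul_of_nonneg_left (hVu x) (by positivity))
    (by positivity) (by rwa [hfin])
  have hg : ∀ x, gradient u x = 0 := fun x => by
    rw [hu0]
    simp [gradient]
  refine ⟨?_, ?_⟩
  · simp only [hg, hH.zero, hB.2.1]
    exact integrable_zero _ _ _
  · simp only [hu0, Pi.zero_apply, abs_zero, Real.zero_rpow (by linarith : q + 1 ≠ 0)]
    exact integrable_zero _ _ _
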